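/- Let f₁₂ ∈ ℚ[x] be the polynomial f₁₂(x) = x^12 - 12x^10 + 8x^9 + 21x^8 - 36x^7 + 192x^6 - 240x^5 - 84x^4 + 68x^3 - 72x^2 + 48x + 5. Then f₁₂ is irreducible over ℚ, the Galois group of f₁₂ over ℚ has cardinality 95040 (the order of the Mathieu group M₁₂), and the number field K = ℚ[x]/(f₁₂) has discriminant of absolute value 2^24·3^12·29^4. -/

import Mathlib

open Polynomial

/-- The 132 hexads of a Steiner system `S(5, 6, 12)`, as sorted lists. -/
def hexadList : List (List (Fin 12)) :=
  [[0, 1, 2, 3, 4, 9], [0, 1, 2, 3, 5, 11], [0, 1, 2, 3, 6, 7], [0, 1, 2, 3, 8, 10],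
   [0, 1, 2, 4, 5, 7], [0, 1, 2, 4, 6, 8], [0, 1, 2, 4, 10, 11], [0, 1, 2, 5, 6, 10],
   [0, 1, 2, 5, 8, 9], [0, 1, 2, 6, 9, 11], [0, 1, 2, 7, 8, 11], [0, 1, 2, 7, 9, 10],
   [0, 1, 3, 4, 5, 8], [0, 1, 3, 4, 6, 10], [0, 1, 3, 4, 7, 11], [0, 1, 3, 5, 6, 9],
   [0, 1, 3, 5, 7, 10], [0, 1, 3, 6, 8, 11], [0, 1, 3, 7, 8, 9], [0, 1, 3, 9, 10, 11],
   [0, 1, 4, 5, 6, 11], [0, 1, 4, 5, 9, 10], [0, 1, 4, 6, 7, 9], [0, 1, 4, 7, 8, 10],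
   [0, 1, 4, 8, 9, 11], [0, 1, 5, 6, 7, 8], [0, 1, 5, 7, 9, 11], [0, 1, 5, 8, 10, 11],
   [0, 1, 6, 7, 10, 11], [0, 1, 6, 8, 9, 10], [0, 2, 3, 4, 5, 6], [0, 2, 3, 4, 7, 10],
   [0, 2, 3, 4, 8, 11], [0, 2, 3, 5, 7, 8], [0, 2, 3, 5, 9, 10], [0, 2, 3, 6, 8, 9],
   [0, 2, 3, 6, 10, 11], [0, 2, 3, 7, 9, 11], [0, 2, 4, 5, 8, 10], [0, 2, 4, 5, 9, 11],
   [0, 2, 4, 6, 7, 11], [0, 2, 4, 6, 9, 10], [0, 2, 4, 7, 8, 9], [0, 2, 5, 6, 7, 9],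
   [0, 2, 5, 6, 8, 11], [0, 2, 5, 7, 10, 11], [0, 2, 6, 7, 8, 10], [0, 2, 8, 9, 10, 11],
   [0, 3, 4, 5, 7, 9], [0, 3, 4, 5, 10, 11], [0, 3, 4, 6, 7, 8], [0, 3, 4, 6, 9, 11],
   [0, 3, 4, 8, 9, 10], [0, 3, 5, 6, 7, 11], [0, 3, 5, 6, 8, 10], [0, 3, 5, 8, 9, 11],
   [0, 3, 6, 7, 9, 10], [0, 3, 7, 8, 10, 11], [0, 4, 5, 6, 7, 10], [0, 4, 5, 6, 8, 9],
   [0, 4, 5, 7, 8, 11], [0, 4, 6, 8, 10, 11], [0, 4, 7, 9, 10, 11], [0, 5, 6, 9, 10, 11],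
   [0, 5, 7, 8, 9, 10], [0, 6, 7, 8, 9, 11], [1, 2, 3, 4, 5, 10], [1, 2, 3, 4, 6, 11],
   [1, 2, 3, 4, 7, 8], [1, 2, 3, 5, 6, 8], [1, 2, 3, 5, 7, 9], [1, 2, 3, 6, 9, 10],
   [1, 2, 3, 7, 10, 11], [1, 2, 3, 8, 9, 11], [1, 2, 4, 5, 6, 9], [1, 2, 4, 5, 8, 11],
   [1, 2, 4, 6, 7, 10], [1, 2, 4, 7, 9, 11], [1, 2, 4, 8, 9, 10], [1, 2, 5, 6, 7, 11],
   [1, 2, 5, 7, 8, 10], [1, 2, 5, 9, 10, 11], [1, 2, 6, 7, 8, 9], [1, 2, 6, 8, 10, 11],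
   [1, 3, 4, 5, 6, 7], [1, 3, 4, 5, 9, 11], [1, 3, 4, 6, 8, 9], [1, 3, 4, 7, 9, 10],
   [1, 3, 4, 8, 10, 11], [1, 3, 5, 6, 10, 11], [1, 3, 5, 7, 8, 11], [1, 3, 5, 8, 9, 10],
   [1, 3, 6, 7, 8, 10], [1, 3, 6, 7, 9, 11], [1, 4, 5, 6, 8, 10], [1, 4, 5, 7, 8, 9],
   [1, 4, 5, 7, 10, 11], [1, 4, 6, 7, 8, 11], [1, 4, 6, 9, 10, 11], [1, 5, 6, 7, 9, 10],
   [1, 5, 6, 8, 9, 11], [1, 7, 8, 9, 10, 11], [2, 3, 4, 5, 7, 11], [2, 3, 4, 5, 8, 9],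
   [2, 3, 4, 6, 7, 9], [2, 3, 4, 6, 8, 10], [2, 3, 4, 9, 10, 11], [2, 3, 5, 6, 7, 10],
   [2, 3, 5, 6, 9, 11], [2, 3, 5, 8, 10, 11], [2, 3, 6, 7, 8, 11], [2, 3, 7, 8, 9, 10],
   [2, 4, 5, 6, 7, 8], [2, 4, 5, 6, 10, 11], [2, 4, 5, 7, 9, 10], [2, 4, 6, 8, 9, 11],
   [2, 4, 7, 8, 10, 11], [2, 5, 6, 8, 9, 10], [2, 5, 7, 8, 9, 11], [2, 6, 7, 9, 10, 11],
   [3, 4, 5, 6, 8, 11], [3, 4, 5, 6, 9, 10], [3, 4, 5, 7, 8, 10], [3, 4, 6, 7, 10, 11],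
   [3, 4, 7, 8, 9, 11], [3, 5, 6, 7, 8, 9], [3, 5, 7, 9, 10, 11], [3, 6, 8, 9, 10, 11],
   [4, 5, 6, 7, 9, 11], [4, 5, 8, 9, 10, 11], [4, 6, 7, 8, 9, 10], [5, 6, 7, 8, 10, 11]]

/-- A permutation of order 11 preserving the hexads. -/
def shift : Equiv.Perm (Fin 12) where
  toFun := ![1, 2, 3, 4, 5, 6, 7, 8, 9, 10, 0, 11]
  invFun := ![10, 0, 1, 2, 3, 4, 5, 6, 7, 8, 9, 11]
  left_inv := by decide
  right_inv := by decide

/-- A permutation of order 11 preserving the hexads. -/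
def twist : Equiv.Perm (Fin 12) where
  toFun := ![3, 10, 11, 7, 4, 2, 5, 9, 0, 6, 8, 1]
  invFun := ![8, 11, 5, 0, 4, 6, 9, 3, 10, 7, 1, 2]
  left_inv := by decide
  right_inv := by decide

/-- Words in `shift` (`true`) and `twist` (`false`): the `k`-th list consists of words fixing
`0, …, k - 1` and carrying `k` to every other point `k, …, 11`. -/
def transversalWords : List (List (List Bool)) :=
  [[[],
    [true],
    [true, true],
    [false],
    [true, false],
    [true, true, false],
    [true, true, true, false],
    [false, false],
    [false, false, true],
    [false, false, false],
    [false, true],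
    [false, true, true]],
   [[],
    [true, true, false, false, false],
    [false, true, false, false, true, false, true],
    [true, true, true, false, false, true],
    [false, false, false, true, false, true, false, false],
    [false, true, false, false],
    [true, false, false, false, true, true],
    [false, false, true, false, false, false],
    [false, false, true, true, false, false, true],
    [false, false, false, true],
    [true, false, true]],
   [[],
    [true, false, true, false, false, true, true, true, false, false],
    [false, true, true, true, false, true, true, true, false],
    [true, true, true, true, false, false],
    [true, false, true, true, false, false, false, true, true],
    [true, false, false, true, true, true, false, true, true],
    [false, true, true, false, true, false, false, true],
    [true, true, false, false, true, true, true, true, false, true],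
    [false, false, false, true, true, true, true, false, false, true],
    [false, false, true, false, false, true, true, false, true, false, true, true]],
   [[],
    [true, false, true, true, false, true, true, false, true, false, true, false, true, true, true],
    [true, true, true, false, true, false, true, false, true, true, false, false],
    [false, false, true, false, false, true, true, true, false, false, false, true],
    [false, true, false, true, false, true, true, false, false, true, false, true, true, true],
    [false, true, true, false, false, true, true, true, false, true, true, true, true],
    [false, true, false, true, true, false, true, false, true, true],
    [false, false, true, true, true, false, false, true, false, true],
    [false, true, true, true, true, true, true, true, true, true, false, true]],
   [[],
    [false, true, true, false, false, false, false, true, false, true, false, false, true, true, false, false, true],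
    [true, false, true, false, true, false, false, false, false, true, true, false, false, false, false, true, true],
    [true, false, true, true, true, true, false, false, true, false, true, false, false, true, false, true],
    [true, false, true, false, true, false, false, true, false, false, false, false, true, false, true, true, true, true],
    [false, true, true, true, true, true, false, false, true, true, false, false, false, false],
    [true, false, true, false, false, true, true, false, false, true, false, true, false, true, true, true],
    [true, false, true, true, true, true, true, true, true, true, true, false]]]

/-- The multiset of hexads. -/
def hexads : Multiset (Finset (Fin 12)) := (hexadList.map List.toFinset : List _)

/-- The group of permutations preserving the hexads, a copy of the Mathieu group `M₁₂`. -/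
def mathieu : Subgroup (Equiv.Perm (Fin 12)) where
  carrier := {π | hexads.map (fun S ↦ S.map π.toEmbedding) = hexads}
  one_mem' := by
    have : ∀ S : Finset (Fin 12), S.map (1 : Equiv.Perm (Fin 12)).toEmbedding = S :=
      fun S ↦ Finset.map_refl
    simp [this]
  mul_mem' := by
    intro π ρ hπ hρ
    simp only [Set.mem_ofPred_eq] at *
    have : ∀ S : Finset (Fin 12), S.map (π * ρ).toEmbedding =
        (S.map ρ.toEmbedding).map π.toEmbedding := fun S ↦ by rw [Finset.map_map]; rfl
    simp only [this]
    conv_rhs => rw [← hπ, ← hρ, Multiset.map_map]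
    rfl
  inv_mem' := by
    intro π hπ
    simp only [Set.mem_ofPred_eq] at *
    conv_lhs => rw [← hπ, Multiset.map_map]
    have : ∀ S : Finset (Fin 12), (S.map π.toEmbedding).map π⁻¹.toEmbedding = S := fun S ↦ by
      rw [Finset.map_map]
      ext x
      simp
    simp [this]

theorem mem_mathieu {π : Equiv.Perm (Fin 12)} :
    π ∈ mathieu ↔ hexads.map (fun S ↦ S.map π.toEmbedding) = hexads := Iff.rfl

theorem mem_mathieu_of_perm {π : Equiv.Perm (Fin 12)}
    (h : (hexadList.map fun l ↦ (l.map π).insertionSort (· ≤ ·)).Perm hexadList) :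
    π ∈ mathieu := by
  have key : ∀ l : List (Fin 12), l.toFinset.map π.toEmbedding =
      ((l.map π).insertionSort (· ≤ ·)).toFinset := by
    intro l
    ext x
    simp only [Finset.mem_map, List.mem_toFinset, List.mem_insertionSort, List.mem_map]
    rfl
  rw [mem_mathieu, hexads, Multiset.map_coe, List.map_map]
  refine Multiset.coe_eq_coe.2 ?_
  have := h.map List.toFinset
  rw [List.map_map] at this
  convert this using 2
  ext1 l
  exact key l

theorem shift_mem_mathieu : shift ∈ mathieu := mem_mathieu_of_perm (by decide +kernel)

theorem twist_mem_mathieu : twist ∈ mathieu := mem_mathieu_of_perm (by decide +kernel)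

/-- Whether all points of `l` lie in a common hexad. -/
def inHexad (l : List (Fin 12)) : Bool := hexadList.any fun m ↦ l.all fun i ↦ m.contains i

theorem inHexad_map {π : Equiv.Perm (Fin 12)} (hπ : π ∈ mathieu) {l : List (Fin 12)}
    (hl : l ∈ hexadList) : inHexad (l.map π) = true := by
  have h1 : l.toFinset.map π.toEmbedding ∈ hexads := by
    rw [← mem_mathieu.1 hπ]
    refine Multiset.mem_map.2 ⟨l.toFinset, ?_, rfl⟩
    exact Multiset.mem_coe.2 (List.mem_map_of_mem hl)
  obtain ⟨m, hm, hml⟩ := List.mem_map.1 (Multiset.mem_coe.1 h1)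
  refine List.any_eq_true.2 ⟨m, hm, List.all_eq_true.2 fun i hi ↦ ?_⟩
  obtain ⟨j, hj, rfl⟩ := List.mem_map.1 hi
  have : π j ∈ m.toFinset := by
    rw [hml]
    exact Finset.mem_map_of_mem π.toEmbedding (List.mem_toFinset.2 hj)
  simpa using this

set_option synthInstance.maxHeartbeats 400000 in
set_option synthInstance.maxSize 1000 in
theorem eq_of_inHexad : ∀ x₉ ∉ [0, 1, 2, 3, 4], inHexad [0, 1, 2, 3, 4, x₉] →
    ∀ x₅ ∉ [0, 1, 2, 3, 4, x₉], ∀ x₁₁ ∉ [0, 1, 2, 3, 4, x₉, x₅], inHexad [0, 1, 2, 3, x₅, x₁₁] →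
    ∀ x₇ ∉ [0, 1, 2, 3, 4, x₉, x₅, x₁₁], inHexad [0, 1, 2, 4, x₅, x₇] →
    ∀ x₈ ∉ [0, 1, 2, 3, 4, x₉, x₅, x₁₁, x₇], inHexad [0, 1, 3, 4, x₅, x₈] →
    ∀ x₆ ∉ [0, 1, 2, 3, 4, x₉, x₅, x₁₁, x₇, x₈], inHexad [0, 2, 3, 4, x₅, x₆] →
    ∀ x₁₀ ∉ [0, 1, 2, 3, 4, x₉, x₅, x₁₁, x₇, x₈, x₆], inHexad [0, 1, 2, 3, x₈, x₁₀] →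
    inHexad [0, 1, 2, 4, x₆, x₈] → inHexad [0, 1, 3, 4, x₆, x₁₀] →
    x₅ = 5 ∧ x₆ = 6 ∧ x₇ = 7 ∧ x₈ = 8 ∧ x₉ = 9 ∧ x₁₀ = 10 ∧ x₁₁ = 11 := by
  decide +kernel

theorem eq_one_of_mem_mathieu {π : Equiv.Perm (Fin 12)} (hπ : π ∈ mathieu)
    (h0 : π 0 = 0) (h1 : π 1 = 1) (h2 : π 2 = 2) (h3 : π 3 = 3) (h4 : π 4 = 4) : π = 1 := by
  have hin : ∀ l ∈ hexadList, inHexad (l.map π) = true := fun l ↦ inHexad_map hπ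
  have hne : ∀ (j : Fin 12) (l : List (Fin 12)), j ∉ l → π j ∉ l.map π := by
    intro j l hj h
    obtain ⟨k, hk, hkj⟩ := List.mem_map.1 h
    exact hj (π.injective hkj ▸ hk)
  have key := eq_of_inHexad (π 9)
    (by simpa [h0, h1, h2, h3, h4] using hne 9 [0, 1, 2, 3, 4] (by decide))
    (by simpa [h0, h1, h2, h3, h4] using hin [0, 1, 2, 3, 4, 9] (by decide)) (π 5)
    (by simpa [h0, h1, h2, h3, h4] using hne 5 [0, 1, 2, 3, 4, 9] (by decide)) (π 11)
    (by simpa [h0, h1, h2, h3, h4] using hne 11 [0, 1, 2, 3, 4, 9, 5] (by decide))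
    (by simpa [h0, h1, h2, h3, h4] using hin [0, 1, 2, 3, 5, 11] (by decide)) (π 7)
    (by simpa [h0, h1, h2, h3, h4] using hne 7 [0, 1, 2, 3, 4, 9, 5, 11] (by decide))
    (by simpa [h0, h1, h2, h3, h4] using hin [0, 1, 2, 4, 5, 7] (by decide)) (π 8)
    (by simpa [h0, h1, h2, h3, h4] using hne 8 [0, 1, 2, 3, 4, 9, 5, 11, 7] (by decide))
    (by simpa [h0, h1, h2, h3, h4] using hin [0, 1, 3, 4, 5, 8] (by decide)) (π 6)
    (by simpa [h0, h1, h2, h3, h4] using hne 6 [0, 1, 2, 3, 4, 9, 5, 11, 7, 8] (by decide))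
    (by simpa [h0, h1, h2, h3, h4] using hin [0, 2, 3, 4, 5, 6] (by decide)) (π 10)
    (by simpa [h0, h1, h2, h3, h4] using hne 10 [0, 1, 2, 3, 4, 9, 5, 11, 7, 8, 6] (by decide))
    (by simpa [h0, h1, h2, h3, h4] using hin [0, 1, 2, 3, 8, 10] (by decide))
    (by simpa [h0, h1, h2, h3, h4] using hin [0, 1, 2, 4, 6, 8] (by decide))
    (by simpa [h0, h1, h2, h3, h4] using hin [0, 1, 3, 4, 6, 10] (by decide))
  obtain ⟨h5, h6, h7, h8, h9, h10, h11⟩ := key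
  ext i
  fin_cases i <;> simp [*]

/-- The images of the first five points. -/
def firstFive (π : Equiv.Perm (Fin 12)) : Fin 5 ↪ Fin 12 :=
  (Fin.castLEEmb (by norm_num)).trans π.toEmbedding

theorem firstFive_injOn_mathieu : Function.Injective fun π : mathieu ↦ firstFive π := by
  intro π ρ h
  have key : ∀ i : Fin 5, (π : Equiv.Perm (Fin 12)) (Fin.castLE (by norm_num) i) =
      (ρ : Equiv.Perm (Fin 12)) (Fin.castLE (by norm_num) i) := fun i ↦ DFunLike.congr_fun h i
  have h1 : ρ⁻¹ * π = 1 := by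
    refine Subtype.ext (eq_one_of_mem_mathieu (ρ⁻¹ * π).2 ?_ ?_ ?_ ?_ ?_) <;>
      simp only [Subgroup.coe_mul, Subgroup.coe_inv, Equiv.Perm.mul_apply,
        Equiv.Perm.inv_eq_iff_eq]
    exacts [key 0, key 1, key 2, key 3, key 4]
  exact (inv_mul_eq_one.1 h1).symm

theorem card_embedding_five : Fintype.card (Fin 5 ↪ Fin 12) = 95040 := by
  rw [Fintype.card_embedding_eq]
  decide +kernel

theorem card_mathieu_le : Nat.card mathieu ≤ 95040 := by
  rw [← card_embedding_five, ← Nat.card_eq_fintype_card]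
  exact Nat.card_le_card_of_injective _ firstFive_injOn_mathieu

/-- The permutation spelled by a word. -/
def ofWord : List Bool → Equiv.Perm (Fin 12)
  | [] => 1
  | b :: w => (if b then shift else twist) * ofWord w

theorem ofWord_mem {G : Subgroup (Equiv.Perm (Fin 12))} (hs : shift ∈ G) (ht : twist ∈ G)
    (w : List Bool) : ofWord w ∈ G := by
  induction w with
  | nil => exact G.one_mem
  | cons b w ih => cases b <;> simp [ofWord, G.mul_mem, hs, ht, ih]

/-- A weak form of the orbit-stabilizer theorem, for a list of points in the orbit. -/
theorem mul_card_stabilizer_le {α : Type*} [Finite α] (N : Subgroup (Equiv.Perm α)) (x : α)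
    (l : List α) (hl : l.Nodup) (h : ∀ y ∈ l, ∃ g ∈ N, g x = y) :
    l.length * Nat.card ↥(N ⊓ MulAction.stabilizer (Equiv.Perm α) x) ≤ Nat.card N := by
  choose! g hg hgx using h
  have := Nat.card_le_card_of_injective
    (fun p : {y // y ∈ l} × ↥(N ⊓ MulAction.stabilizer (Equiv.Perm α) x) ↦
      (⟨g p.1 * p.2, N.mul_mem (hg _ p.1.2) p.2.2.1⟩ : N)) ?_
  · classical
    rwa [Nat.card_prod, Nat.card_eq_fintype_card, Fintype.card_of_subtype l.toFinset (by simp),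
      List.toFinset_card_of_nodup hl] at this
  · rintro ⟨⟨y, hy⟩, n⟩ ⟨⟨z, hz⟩, m⟩ h
    have h' : g y * (n : Equiv.Perm α) = g z * m := congrArg Subtype.val h
    have hn : (n : Equiv.Perm α) x = x := n.2.2
    have hm : (m : Equiv.Perm α) x = x := m.2.2
    have hyz : y = z := by
      have := congrArg (fun p : Equiv.Perm α ↦ p x) h'
      simpa [hn, hm, hgx y hy, hgx z hz] using this
    subst hyz
    rw [Subtype.ext (mul_left_cancel h') (a1 := n) (a2 := m)]

theorem transversalWords_spec : ∀ k : Fin 5,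
    (transversalWords[(k : ℕ)]!.map fun w ↦ ofWord w (Fin.castLE (by norm_num) k)) =
      (List.finRange 12).drop k ∧
    ∀ w ∈ transversalWords[(k : ℕ)]!, ∀ j < k,
      ofWord w (Fin.castLE (by norm_num) j) = Fin.castLE (by norm_num) j := by
  decide +kernel

/-- The pointwise stabilizer in `G` of the first `k` points. -/
def prefixStabilizer (G : Subgroup (Equiv.Perm (Fin 12))) : ℕ → Subgroup (Equiv.Perm (Fin 12))
  | 0 => G
  | k + 1 => prefixStabilizer G k ⊓ MulAction.stabilizer (Equiv.Perm (Fin 12)) (Fin.ofNat 12 k)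

theorem mem_prefixStabilizer {G : Subgroup (Equiv.Perm (Fin 12))} {k : ℕ}
    {π : Equiv.Perm (Fin 12)} :
    π ∈ prefixStabilizer G k ↔ π ∈ G ∧ ∀ j < k, π (Fin.ofNat 12 j) = Fin.ofNat 12 j := by
  induction k with
  | zero => simp [prefixStabilizer]
  | succ k ih =>
    simp only [prefixStabilizer, Subgroup.mem_inf, ih, MulAction.mem_stabilizer_iff,
      Equiv.Perm.smul_def, Nat.lt_succ_iff_lt_or_eq, or_imp, forall_and, forall_eq, and_assoc]

theorem card_prefixStabilizer_le {G : Subgroup (Equiv.Perm (Fin 12))} (hs : shift ∈ G)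
    (ht : twist ∈ G) (k : Fin 5) :
    (12 - k) * Nat.card (prefixStabilizer G (k + 1)) ≤ Nat.card (prefixStabilizer G k) := by
  obtain ⟨h1, h2⟩ := transversalWords_spec k
  have h3 := mul_card_stabilizer_le (prefixStabilizer G k) (Fin.ofNat 12 k)
    ((List.finRange 12).drop k) ((List.nodup_finRange 12).sublist (List.drop_sublist _ _)) ?_
  · rwa [List.length_drop, List.length_finRange] at h3
  · intro y hy
    rw [← h1] at hy
    obtain ⟨w, hw, rfl⟩ := List.mem_map.1 hy
    have e : ∀ j : Fin 5, Fin.castLE (by norm_num) j = Fin.ofNat 12 j := by decide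
    refine ⟨ofWord w, mem_prefixStabilizer.2 ⟨ofWord_mem hs ht w, fun j hj ↦ ?_⟩, ?_⟩
    · have := h2 w hw ⟨j, hj.trans k.2⟩ hj
      rwa [e] at this
    · rw [e]

theorem le_card_of_shift_twist_mem {G : Subgroup (Equiv.Perm (Fin 12))} (hs : shift ∈ G)
    (ht : twist ∈ G) : 95040 ≤ Nat.card G := by
  have h0 := card_prefixStabilizer_le hs ht 0
  have h1 := card_prefixStabilizer_le hs ht 1
  have h2 := card_prefixStabilizer_le hs ht 2
  have h3 := card_prefixStabilizer_le hs ht 3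
  have h4 := card_prefixStabilizer_le hs ht 4
  have h5 : 0 < Nat.card (prefixStabilizer G 5) := Nat.card_pos
  change 12 * Nat.card (prefixStabilizer G 1) ≤ Nat.card G at h0
  change 11 * Nat.card (prefixStabilizer G 2) ≤ Nat.card (prefixStabilizer G 1) at h1
  change 10 * Nat.card (prefixStabilizer G 3) ≤ Nat.card (prefixStabilizer G 2) at h2
  change 9 * Nat.card (prefixStabilizer G 4) ≤ Nat.card (prefixStabilizer G 3) at h3
  change 8 * Nat.card (prefixStabilizer G 5) ≤ Nat.card (prefixStabilizer G 4) at h4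
  omega

theorem card_mathieu : Nat.card mathieu = 95040 :=
  le_antisymm card_mathieu_le (le_card_of_shift_twist_mem shift_mem_mathieu twist_mem_mathieu)

theorem index_mathieu : mathieu.index = 5040 := by
  have h := mathieu.card_mul_index
  rw [card_mathieu, Nat.card_eq_fintype_card, Fintype.card_perm, Fintype.card_fin] at h
  have : Nat.factorial 12 = 95040 * 5040 := by decide +kernel
  omega

/-- `M₁₂` is 5-transitive. -/
theorem exists_mem_mathieu_firstFive_eq (e : Fin 5 ↪ Fin 12) : ∃ π ∈ mathieu, firstFive π = e := by
  have h : Function.Bijective fun π : mathieu ↦ firstFive π := by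
    refine (Nat.bijective_iff_injective_and_card _).2 ⟨firstFive_injOn_mathieu, ?_⟩
    rw [card_mathieu, Nat.card_eq_fintype_card, card_embedding_five]
  obtain ⟨π, hπ⟩ := h.2 e
  exact ⟨π, π.2, hπ⟩

theorem mem_of_pow_prime_of_index_lt {G : Type*} [Group G] {H : Subgroup G} {p : ℕ}
    (hp : p.Prime) (hH : H.index ≠ 0) (hlt : H.index < p) {g : G} (hg : g ^ p = 1) : g ∈ H := by
  obtain ⟨n, hn0, hn, hmem⟩ := H.exists_pow_mem_of_index_ne_zero hH g
  have hcop : IsCoprime (n : ℤ) p :=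
    (Nat.Coprime.isCoprime (hp.coprime_iff_not_dvd.2 fun h ↦
      (hn.trans_lt hlt).not_ge (Nat.le_of_dvd hn0 h)).symm)
  obtain ⟨u, v, huv⟩ := hcop
  have : g = (g ^ n) ^ u := by
    calc g = g ^ (u * n + v * p) := by rw [huv, zpow_one]
      _ = (g ^ n) ^ u := by
        rw [zpow_add, mul_comm u, mul_comm v, zpow_mul, zpow_mul]
        simp [hg]
  rw [this]
  exact H.zpow_mem hmem u

/-- A subgroup of `M₁₂` whose order is divisible by 15840 has index less than 11, so it contains
all elements of order 11, and is everything. -/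
theorem card_eq_of_le_mathieu {G : Subgroup (Equiv.Perm (Fin 12))} (hG : G ≤ mathieu)
    (h : 15840 ∣ Nat.card G) : Nat.card G = 95040 := by
  refine le_antisymm (card_mathieu ▸ Subgroup.card_le_of_le hG) ?_
  have hidx : (G.subgroupOf mathieu).index * Nat.card G = 95040 := by
    rw [← card_mathieu, ← (G.subgroupOf mathieu).card_mul_index, mul_comm,
      Nat.card_congr (Subgroup.subgroupOfEquivOfLe hG).toEquiv]
  have hpos : 0 < Nat.card G := Nat.card_pos
  have hle := Nat.le_of_dvd hpos h
  have h0 : (G.subgroupOf mathieu).index ≠ 0 := by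
    rintro h0
    simp [h0] at hidx
  have hlt : (G.subgroupOf mathieu).index < 11 := by nlinarith
  have key : ∀ g (hg : g ∈ mathieu), g ^ 11 = 1 → g ∈ G := fun g hg h11 ↦
    mem_of_pow_prime_of_index_lt (by norm_num : Nat.Prime 11) h0 hlt
      (g := (⟨g, hg⟩ : mathieu)) (Subtype.ext h11)
  exact le_card_of_shift_twist_mem
    (key _ shift_mem_mathieu (Equiv.ext (by decide +kernel)))
    (key _ twist_mem_mathieu (Equiv.ext (by decide +kernel)))

/-- A transitive group containing an element of order 11 with a fixed point is 2-transitive. -/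
theorem exists_mem_pair_eq {G : Subgroup (Equiv.Perm (Fin 12))}
    (hmove : ∀ i, ∃ g ∈ G, g i ≠ i) (h11 : ∃ g ∈ G, ∃ i, g i = i ∧ orderOf g = 11)
    {i j k l : Fin 12} (hij : i ≠ j) (hkl : k ≠ l) : ∃ g ∈ G, g i = k ∧ g j = l := by
  obtain ⟨c, hc, i₀, hci, hord⟩ := h11
  have hcyc : c.IsCycle := Equiv.Perm.isCycle_of_prime_order' (by rw [hord]; norm_num)
    (by rw [hord]; simp)
  have hsupp : c.support = {i₀}ᶜ := by
    refine Finset.eq_of_subset_of_card_le (fun i hi ↦ ?_) ?_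
    · rw [Finset.mem_compl, Finset.mem_singleton]
      rintro rfl
      exact Equiv.Perm.mem_support.1 hi hci
    · rw [← hcyc.orderOf, hord, Finset.card_compl]
      simp
  have hpow : ∀ j k, j ≠ i₀ → k ≠ i₀ → ∃ g ∈ G, g i₀ = i₀ ∧ g j = k := by
    intro j k hj hk
    have hj' : c j ≠ j := Equiv.Perm.mem_support.1 (by simpa [hsupp] using hj)
    have hk' : c k ≠ k := Equiv.Perm.mem_support.1 (by simpa [hsupp] using hk)
    obtain ⟨n, hn⟩ := hcyc.exists_pow_eq hj' hk'
    exact ⟨c ^ n, G.pow_mem hc n, Function.IsFixedPt.perm_pow hci n, hn⟩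
  have htrans : ∀ j, ∃ g ∈ G, g j = i₀ := by
    intro j
    by_cases hj : j = i₀
    · exact ⟨1, G.one_mem, hj⟩
    obtain ⟨m, hm, hmi⟩ := hmove i₀
    obtain ⟨g, hg, -, hgj⟩ := hpow j (m i₀) hj hmi
    exact ⟨m⁻¹ * g, G.mul_mem (G.inv_mem hm) hg, by simp [hgj]⟩
  obtain ⟨g, hg, hgi⟩ := htrans i
  obtain ⟨m, hm, hmk⟩ := htrans k
  obtain ⟨n, hn, hni, hnj⟩ := hpow (g j) (m l) (by rw [← hgi]; exact g.injective.ne hij.symm)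
    (by rw [← hmk]; exact m.injective.ne hkl.symm)
  refine ⟨m⁻¹ * n * g, G.mul_mem (G.mul_mem (G.inv_mem hm) hn) hg, ?_, ?_⟩
  · rw [Equiv.Perm.mul_apply, Equiv.Perm.mul_apply, hgi, hni, Equiv.Perm.inv_eq_iff_eq, hmk]
  · rw [Equiv.Perm.mul_apply, Equiv.Perm.mul_apply, hnj, Equiv.Perm.inv_eq_iff_eq]

theorem dvd_card_of_fixed_points {G : Subgroup (Equiv.Perm (Fin 12))}
    (hmove : ∀ i, ∃ g ∈ G, g i ≠ i) (h11 : ∃ g ∈ G, ∃ i, g i = i ∧ orderOf g = 11)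
    (h : ∀ n ∈ [8, 5, 3], ∃ g ∈ G, ∃ i j, i ≠ j ∧ g i = i ∧ g j = j ∧ orderOf g = n) :
    15840 ∣ Nat.card G := by
  have hdvd : ∀ n ∈ [8, 5, 3], 132 * n ∣ Nat.card G := by
    intro n hn
    obtain ⟨g, hg, i, j, hij, hgi, hgj, hgn⟩ := h n hn
    have horb : MulAction.orbit G (i, j) = {p : Fin 12 × Fin 12 | p.1 ≠ p.2} := by
      ext ⟨k, l⟩
      constructor
      · rintro ⟨m, hm⟩
        have h1 : (m : Equiv.Perm (Fin 12)) i = k := congrArg Prod.fst hm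
        have h2 : (m : Equiv.Perm (Fin 12)) j = l := congrArg Prod.snd hm
        change k ≠ l
        rw [← h1, ← h2]
        exact (m : Equiv.Perm (Fin 12)).injective.ne hij
      · intro hkl
        obtain ⟨m, hm, h1, h2⟩ := exists_mem_pair_eq hmove h11 hij hkl
        exact ⟨⟨m, hm⟩, Prod.ext h1 h2⟩
    have hcard : (MulAction.orbit G (i, j)).ncard = 132 := by
      rw [horb, Set.ncard_eq_toFinset_card']
      decide +kernel
    rw [← (MulAction.stabilizer G (i, j)).index_mul_card, MulAction.index_stabilizer, hcard]
    refine mul_dvd_mul_left _ ?_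
    have hmem : (⟨g, hg⟩ : G) ∈ MulAction.stabilizer G (i, j) := Prod.ext hgi hgj
    have := Subgroup.orderOf_dvd_natCard _ hmem
    rwa [Subgroup.orderOf_mk, hgn] at this
  have h8 := hdvd 8 (by simp)
  have h5 := hdvd 5 (by simp)
  have h3 := hdvd 3 (by simp)
  omega

/-- Force the evaluation of a natural number before it is passed on. -/
def force {α : Type} (n : ℕ) (k : ℕ → α) : α := Nat.casesOn n (k 0) fun m ↦ k m.succ

theorem force_eq {α : Type} (n : ℕ) (k : ℕ → α) : force n k = k n := by cases n <;> rfl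

/-- Multilinear polynomials in `n` variables with natural coefficients. -/
def MultTree : ℕ → Type
  | 0 => ℕ
  | n + 1 => MultTree n × MultTree n

namespace MultTree

/-- The zero polynomial. -/
def zero : (n : ℕ) → MultTree n
  | 0 => (0 : ℕ)
  | n + 1 => (zero n, zero n)

/-- Add the monomial that is the product of the marked variables. -/
def insert : (n : ℕ) → List Bool → MultTree n → MultTree n
  | 0, _, c => Nat.succ c
  | n + 1, [], t => (insert n [] t.1, t.2)
  | n + 1, false :: l, t => (insert n l t.1, t.2)
  | n + 1, true :: l, t => (t.1, insert n l t.2)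

/-- Apply `k` to `s + w * t`, with coefficients reduced modulo `m`. -/
def addMul {α : Type} (m w : ℕ) : (n : ℕ) → MultTree n → MultTree n → (MultTree n → α) → α
  | 0, a, b, k => force (Nat.mod (Nat.add a (Nat.mul w b)) m) k
  | n + 1, s, t, k => addMul m w n s.1 t.1 fun a ↦ addMul m w n s.2 t.2 fun b ↦ k (a, b)

variable {R : Type*} [CommRing R]

/-- Evaluation of a multilinear polynomial. -/
def eval : (n : ℕ) → MultTree n → List R → R
  | 0, c, _ => ((show ℕ from c : ℕ) : R)
  | n + 1, t, l => eval n t.1 l.tail + l.headD 0 * eval n t.2 l.tail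

/-- The product of the marked entries of a list. -/
def markedProd : List Bool → List R → R
  | b :: l, x :: v => (if b then x else 1) * markedProd l v
  | _, _ => 1

theorem eval_zero (n : ℕ) (v : List R) : eval n (zero n) v = 0 := by
  induction n generalizing v with
  | zero => exact Nat.cast_zero
  | succ n ih => simp [eval, zero, ih]

theorem eval_insert (n : ℕ) (l : List Bool) (t : MultTree n) (v : List R) (hl : l.length = n)
    (hv : v.length = n) : eval n (insert n l t) v = eval n t v + markedProd l v := by
  induction n generalizing l v with
  | zero =>
    rw [List.length_eq_zero_iff.1 hl]
    exact Nat.cast_succ _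
  | succ n ih =>
    obtain ⟨x, v, rfl⟩ := List.exists_cons_of_length_eq_add_one hv
    obtain ⟨b, l, rfl⟩ := List.exists_cons_of_length_eq_add_one hl
    simp only [List.length_cons, Nat.add_right_cancel_iff] at hl hv
    cases b <;> simp [eval, insert, markedProd, ih l _ v hl hv] <;> ring

theorem exists_addMul_eq {α : Type} (m w n : ℕ) (s t : MultTree n) :
    ∃ u : MultTree n, (∀ k : MultTree n → α, addMul m w n s t k = k u) ∧
      ∀ v : List (ZMod m), eval n u v = eval n s v + (w : ZMod m) * eval n t v := by
  induction n with
  | zero =>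
    refine ⟨Nat.mod (Nat.add s (Nat.mul w t)) m, fun k ↦ force_eq _ _, fun v ↦ ?_⟩
    change ((Nat.mod (Nat.add s (Nat.mul w t)) m : ℕ) : ZMod m) =
      ((show ℕ from s : ℕ) : ZMod m) + w * ((show ℕ from t : ℕ) : ZMod m)
    rw [← Nat.cast_mul, ← Nat.cast_add]
    exact ZMod.natCast_mod _ _
  | succ n ih =>
    obtain ⟨u, hu, hu'⟩ := ih s.1 t.1
    obtain ⟨u₂, hu₂, hu₂'⟩ := ih s.2 t.2
    refine ⟨(u, u₂), fun k ↦ ?_, fun v ↦ ?_⟩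
    · simp only [addMul, hu, hu₂]
    · simp only [eval, hu', hu₂']
      ring

/-- Apply `k` to the partial evaluation of `t` with the first `j` variables given by `l`. -/
def assign {α : Type} (m n : ℕ) : (j : ℕ) → (l : List ℕ) → MultTree (n + j) →
    (MultTree n → α) → α
  | 0, _, t, k => k t
  | j + 1, l, t, k => addMul m (l.headD 0) (n + j) t.1 t.2 fun t' ↦ assign m n j l.tail t' k

theorem exists_assign_eq {α : Type} (m n j : ℕ) (l : List ℕ) (hl : l.length = j)
    (t : MultTree (n + j)) :
    ∃ u : MultTree n, (∀ k : MultTree n → α, assign m n j l t k = k u) ∧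
      ∀ v : List (ZMod m), eval n u v = eval (n + j) t (l.map (↑) ++ v) := by
  induction j generalizing l with
  | zero =>
    rw [List.length_eq_zero_iff.1 hl]
    exact ⟨t, fun _ ↦ rfl, fun _ ↦ rfl⟩
  | succ j ih =>
    obtain ⟨w, l, rfl⟩ := List.exists_cons_of_length_eq_add_one hl
    obtain ⟨t', ht, ht'⟩ := exists_addMul_eq (α := α) m w (n + j) t.1 t.2
    obtain ⟨u, hu, hu'⟩ := ih l (by simpa using hl) t'
    refine ⟨u, fun k ↦ ?_, fun v ↦ ?_⟩
    · rw [← hu k]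
      exact ht _
    · rw [hu' v, ht']
      rfl

/-- Whether all rearrangements `v` of `l` with `eval n t v = c` modulo `m` are equal to `l`;
the value is `true` if moreover `b` holds or there are no such `v`. -/
def search (m c : ℕ) : (n : ℕ) → MultTree n → List ℕ → Bool → Bool
  | 0, a, _, b => b || !(Nat.beq (Nat.mod a m) (Nat.mod c m))
  | n + 1, t, l, b => l.all fun w ↦ addMul m w n t.1 t.2 fun t' ↦
      search m c n t' (l.erase w) (b && Nat.beq w (l.headD 0))

theorem eq_of_search {m c n : ℕ} {t : MultTree n} {l : List ℕ} {b : Bool}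
    (h : search m c n t l b = true) (hl : l.length = n) {v : List ℕ} (hv : v.Perm l)
    (hc : eval n t (v.map (↑) : List (ZMod m)) = c) : b = true ∧ v = l := by
  induction n generalizing l b v with
  | zero =>
    rw [List.length_eq_zero_iff] at hl
    subst hl
    refine ⟨?_, hv.eq_nil⟩
    have hc' : (((show ℕ from t : ℕ)) : ZMod m) = c := hc
    rw [ZMod.natCast_eq_natCast_iff'] at hc'
    have : Nat.beq (Nat.mod t m) (Nat.mod c m) = true := Nat.beq_eq.mpr hc'
    simpa [search, this] using h
  | succ n ih =>
    obtain ⟨x, v, rfl⟩ := List.exists_cons_of_length_eq_add_one (hv.length_eq.trans hl)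
    obtain ⟨hx, hv'⟩ := List.cons_perm_iff_perm_erase.1 hv
    have h' := List.all_eq_true.1 h x hx
    obtain ⟨u, hu, hu'⟩ := exists_addMul_eq (α := Bool) m x n t.1 t.2
    rw [hu] at h'
    obtain ⟨hb, rfl⟩ := ih h' (by rw [List.length_erase_of_mem hx, hl]; rfl) hv'
      (by rw [hu']; exact hc)
    rw [Bool.and_eq_true] at hb
    refine ⟨hb.1, ?_⟩
    obtain ⟨y, l, rfl⟩ := List.exists_cons_of_length_eq_add_one hl
    have : x = y := Nat.eq_of_beq_eq_true hb.2
    rw [this, List.erase_cons_head]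

end MultTree

/-- The sum over the hexads of the products of the corresponding entries. -/
def hexadSum {R : Type*} [CommRing R] (v : Fin 12 → R) : R :=
  (hexads.map fun S ↦ ∏ i ∈ S, v i).sum

/-- The sum over the hexads as a multilinear polynomial. -/
def hexadTree : MultTree 12 :=
  hexadList.foldr (fun l t ↦ MultTree.insert 12 ((List.finRange 12).map fun i ↦ l.contains i) t)
    (MultTree.zero 12)

theorem MultTree.markedProd_ofFn {R : Type*} [CommRing R] {n : ℕ} (g : Fin n → Bool)
    (v : Fin n → R) :
    MultTree.markedProd (List.ofFn g) (List.ofFn v) = ∏ i, if g i then v i else 1 := by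
  induction n with
  | zero => simp [markedProd]
  | succ n ih => rw [List.ofFn_succ, List.ofFn_succ, markedProd, ih, Fin.prod_univ_succ]

theorem eval_hexadTree {R : Type*} [CommRing R] (v : Fin 12 → R) :
    MultTree.eval 12 hexadTree (List.ofFn v) = hexadSum v := by
  rw [hexadSum, hexads, Multiset.map_coe, Multiset.sum_coe, hexadTree]
  induction hexadList with
  | nil => exact MultTree.eval_zero _ _
  | cons l L ih =>
    rw [List.foldr_cons, MultTree.eval_insert _ _ _ _ (by simp) (by simp), ih, List.map_cons,
      List.map_cons, List.sum_cons, add_comm, ← List.ofFn_eq_map, MultTree.markedProd_ofFn]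
    congr 1
    rw [← Finset.prod_filter]
    refine Finset.prod_congr ?_ fun _ _ ↦ rfl
    ext i
    simp

theorem map_hexadSum {R S : Type*} [CommRing R] [CommRing S] (φ : R →+* S) (v : Fin 12 → R) :
    φ (hexadSum v) = hexadSum fun i ↦ φ (v i) := by
  simp only [hexadSum, map_multiset_sum, Multiset.map_map, Function.comp_def, map_prod]

theorem hexadSum_comp {R : Type*} [CommRing R] (v : Fin 12 → R) {π : Equiv.Perm (Fin 12)}
    (hπ : π ∈ mathieu) : hexadSum (fun i ↦ v (π i)) = hexadSum v := by
  rw [hexadSum, hexadSum]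
  conv_rhs => rw [← mem_mathieu.1 hπ, Multiset.map_map]
  simp

/-- The polynomial with given coefficients, in increasing degree. -/
noncomputable def ofCoeffs (l : List ℤ) : ℤ[X] := l.foldr (fun c q ↦ C c + X * q) 0

/-- Evaluation of the polynomial with given coefficients by Horner's rule. -/
def horner {R : Type*} [CommRing R] (l : List ℤ) (x : R) : R :=
  l.foldr (fun (c : ℤ) (y : R) ↦ (c : R) + x * y) 0

theorem aeval_ofCoeffs {R : Type*} [CommRing R] (l : List ℤ) (x : R) :
    aeval x (ofCoeffs l) = horner l x := by
  induction l with
  | nil => simp [ofCoeffs, horner]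
  | cons c l ih =>
    change aeval x (C c + X * ofCoeffs l) = c + x * horner l x
    simp [ih]

/-- Horner's rule for residues modulo `m`. -/
def hornerMod (m : ℕ) (l : List ℤ) (x : ℕ) : ℕ :=
  l.foldr (fun c y ↦ Nat.mod (Nat.add (Int.toNat (Int.emod c (Int.ofNat m))) (Nat.mul x y)) m) 0

theorem cast_hornerMod {m : ℕ} (hm : m ≠ 0) (l : List ℤ) (x : ℕ) :
    (hornerMod m l x : ZMod m) = horner l (x : ZMod m) := by
  induction l with
  | nil => simp [hornerMod, horner]
  | cons c l ih =>
    change (((c % (m : ℤ)).toNat + x * hornerMod m l x) % m : ℕ) = (c : ZMod m) + x * horner l _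
    have h : (((c % (m : ℤ)).toNat : ℤ) : ZMod m) = c := by
      rw [Int.toNat_of_nonneg (Int.emod_nonneg _ (by exact_mod_cast hm)), ZMod.intCast_mod]
    rw [ZMod.natCast_mod, Nat.cast_add, Nat.cast_mul, ih, ← h, Int.cast_natCast]

/-- The coefficients of `f₁₂`. -/
def coeffs₁₂ : List ℤ := [5, 48, -72, 68, -84, -240, 192, -36, 21, 8, -12, 0, 1]

/-- The coefficients of the derivative of `f₁₂`. -/
def derivCoeffs₁₂ : List ℤ := [48, -144, 204, -336, -1200, 1152, -252, 168, 72, -120, 0, 12]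

/-- The polynomial `f₁₂` with integral coefficients. -/
noncomputable def f₁₂ : ℤ[X] := ofCoeffs coeffs₁₂

theorem f₁₂_eq : f₁₂ = X ^ 12 - 12 * X ^ 10 + 8 * X ^ 9 + 21 * X ^ 8 - 36 * X ^ 7 + 192 * X ^ 6
    - 240 * X ^ 5 - 84 * X ^ 4 + 68 * X ^ 3 - 72 * X ^ 2 + 48 * X + 5 := by
  simp [f₁₂, ofCoeffs, coeffs₁₂]
  ring

theorem derivative_f₁₂ : derivative f₁₂ = ofCoeffs derivCoeffs₁₂ := by
  simp [f₁₂_eq, ofCoeffs, derivCoeffs₁₂, derivative_pow]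
  ring

theorem natDegree_f₁₂ : f₁₂.natDegree = 12 := by
  rw [f₁₂_eq]
  compute_degree!

theorem monic_f₁₂ : f₁₂.Monic := by
  rw [Monic, leadingCoeff, natDegree_f₁₂, f₁₂_eq]
  simp [coeff_X, coeff_X_pow, coeff_ofNat_mul]

/-- Apply `k` to the result of `r` steps of Newton's method for `f₁₂`, starting from an approximate
root `b` modulo `m`, where `v` is the inverse of the derivative at `b`; each step squares `m`. -/
def newton {α : Type} : (r m b v : ℕ) → (ℕ → α) → α
  | 0, _, b, _, k => k b
  | r + 1, m, b, v, k =>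
    force (m * m) fun m ↦ force ((b + (m - hornerMod m coeffs₁₂ b) * v) % m) fun b ↦
      force (v * (2 + (m - hornerMod m derivCoeffs₁₂ b * v % m)) % m) fun v ↦ newton r m b v k

theorem exists_newton_eq {α : Type} (r m b v : ℕ) :
    ∃ B, ∀ k : ℕ → α, newton r m b v k = k B := by
  induction r generalizing m b v with
  | zero => exact ⟨b, fun _ ↦ rfl⟩
  | succ r ih =>
    simp only [newton, force_eq]
    exact ih _ _ _

/-- Apply `k` to the list of refined roots. -/
def newtonList {α : Type} (r m : ℕ) : List (ℕ × ℕ) → (List ℕ → α) → α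
  | [], k => k []
  | q :: l, k => newton r m q.1 q.2 fun B ↦ newtonList r m l fun L ↦ k (B :: L)

theorem exists_newtonList_eq {α : Type} (r m : ℕ) (l : List (ℕ × ℕ)) :
    ∃ L, ∀ k : List ℕ → α, newtonList r m l k = k L := by
  induction l with
  | nil => exact ⟨[], fun _ ↦ rfl⟩
  | cons q l ih =>
    obtain ⟨B, hB⟩ := exists_newton_eq (α := α) r m q.1 q.2
    obtain ⟨L, hL⟩ := ih
    exact ⟨B :: L, fun k ↦ by rw [newtonList, hB, hL]⟩

/-- A prime number that splits completely in the splitting field of `f₁₂`. -/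
abbrev splitPrime : ℕ := 1857281

instance : Fact splitPrime.Prime := ⟨by norm_num⟩

/-- The roots of `f₁₂` modulo `splitPrime`, and the inverses of its derivative at the roots. -/
def rootTable : List (ℕ × ℕ) :=
  [(25648, 1375329), (118818, 828035), (319973, 450489), (347975, 1427305), (371111, 1569433),
   (660318, 275105), (1098423, 1750059), (1353745, 44804), (654492, 572660), (1571482, 1479596),
   (1854690, 1204965), (909730, 165906)]

/-- The roots of `f₁₂` modulo `splitPrime`. -/
def rootMod (i : Fin 12) : ℕ := (rootTable[i]).1

/-- Whether the refined roots are roots to high precision and have the expected sum over the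
hexads. -/
def precisionCheck (r : ℕ) : Bool :=
  force (splitPrime ^ 2 ^ r) fun m ↦ newtonList r splitPrime rootTable fun L ↦
    Nat.beq L.length 12 &&
    (L.map (Nat.mod · splitPrime) == rootTable.map Prod.fst) &&
    (L.all fun B ↦ Nat.beq (hornerMod m coeffs₁₂ B) 0) &&
    MultTree.assign m 0 12 L hexadTree fun c ↦ Nat.beq c 228

theorem precisionCheck_eq_true : precisionCheck 13 = true := by decide +kernel

/-- Whether the sum over the hexads distinguishes the permutations of the roots modulo `splitPrime`
that fix the first five. -/
def separationCheck : Bool :=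
  MultTree.assign splitPrime 7 5 ((rootTable.map Prod.fst).take 5) hexadTree fun t ↦
    MultTree.search splitPrime 228 7 t ((rootTable.map Prod.fst).drop 5) true

theorem separationCheck_eq_true : separationCheck = true := by decide +kernel

theorem map_horner {R S : Type*} [CommRing R] [CommRing S] (φ : R →+* S) (l : List ℤ) (x : R) :
    φ (horner l x) = horner l (φ x) := by
  rw [← aeval_ofCoeffs, ← aeval_ofCoeffs, aeval_def, aeval_def, hom_eval₂]
  congr 1
  exact RingHom.ext_int _ _

/-- A monic polynomial with as many known roots as its degree is determined by them. -/
theorem eq_prod_X_sub_C_of_aeval_eq_zero {R A : Type*} [CommRing R] [CommRing A] [IsDomain A]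
    [Algebra R A] {n : ℕ} {f : R[X]} (hf : f.Monic) (hn : f.natDegree = n) {a : Fin n → A}
    (ha : Function.Injective a) (h : ∀ i, aeval (a i) f = 0) :
    f.map (algebraMap R A) = ∏ i, (X - C (a i)) := by
  have hm : (f.map (algebraMap R A)).Monic := hf.map _
  have hroots : (f.map (algebraMap R A)).roots = Finset.univ.val.map a := by
    symm
    refine Multiset.eq_of_le_of_card_le ?_ ?_
    · refine (Multiset.le_iff_subset (Finset.univ.nodup.map ha)).2 fun x hx ↦ ?_
      obtain ⟨i, -, rfl⟩ := Multiset.mem_map.1 hx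
      rw [mem_roots hm.ne_zero, IsRoot, eval_map_algebraMap, h i]
    · refine (card_roots' _).trans ?_
      rw [hf.natDegree_map, hn]
      simp
  have := prod_multiset_X_sub_C_of_monic_of_roots_card_eq hm
    (by rw [hroots, hf.natDegree_map, hn]; simp)
  rw [← this, hroots, Multiset.map_map]
  rfl

theorem aeval_eq_prod_sub {A : Type*} [CommRing A] [IsDomain A] {a : Fin 12 → A}
    (ha : Function.Injective a) (h : ∀ i, aeval (a i) f₁₂ = 0) (x : A) :
    aeval x f₁₂ = ∏ i, (x - a i) := by
  rw [← eval_map_algebraMap, eq_prod_X_sub_C_of_aeval_eq_zero monic_f₁₂ natDegree_f₁₂ ha h,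
    eval_prod]
  simp

section Padic

variable {p : ℕ} [Fact p.Prime]

theorem PadicInt.toZMod_eq_zero_iff {x : ℤ_[p]} : PadicInt.toZMod x = 0 ↔ ‖x‖ < 1 := by
  rw [← RingHom.mem_ker, PadicInt.ker_toZMod, IsLocalRing.mem_maximalIdeal, PadicInt.mem_nonunits]

theorem exists_padicInt_root {b : ℕ} (hb : hornerMod p coeffs₁₂ b = 0)
    (hb' : hornerMod p derivCoeffs₁₂ b % p ≠ 0) :
    ∃ a : ℤ_[p], aeval a f₁₂ = 0 ∧ PadicInt.toZMod a = b := by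
  have h0 : p ≠ 0 := (Fact.out : p.Prime).ne_zero
  have key : ∀ l, PadicInt.toZMod (aeval (b : ℤ_[p]) (ofCoeffs l)) = (hornerMod p l b : ZMod p) := by
    intro l
    rw [aeval_ofCoeffs, map_horner, map_natCast, cast_hornerMod h0]
  have h1 : ‖aeval (b : ℤ_[p]) f₁₂‖ < 1 := by
    rw [← PadicInt.toZMod_eq_zero_iff, f₁₂, key, hb, Nat.cast_zero]
  have h2 : ‖aeval (b : ℤ_[p]) (derivative f₁₂)‖ = 1 := by
    refine le_antisymm (PadicInt.norm_le_one _) (not_lt.1 fun h ↦ hb' ?_)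
    rw [← PadicInt.toZMod_eq_zero_iff, derivative_f₁₂, key, ZMod.natCast_eq_zero_iff] at h
    exact Nat.mod_eq_zero_of_dvd h
  obtain ⟨a, ha, hab, -⟩ := hensels_lemma (F := f₁₂) (a := (b : ℤ_[p])) (by rw [h2]; simpa using h1)
  refine ⟨a, ha, ?_⟩
  rw [h2, ← PadicInt.toZMod_eq_zero_iff, map_sub, map_natCast, sub_eq_zero] at hab
  exact hab

theorem toZModPow_eq_of_hornerMod_eq_zero {a : Fin 12 → ℤ_[p]} (ha : ∀ i, aeval (a i) f₁₂ = 0)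
    (hinj : Function.Injective fun i ↦ PadicInt.toZMod (a i)) {n B : ℕ} {i : Fin 12}
    (hB : PadicInt.toZMod (a i) = B) (hf : hornerMod (p ^ n) coeffs₁₂ B = 0) :
    PadicInt.toZModPow n (a i) = B := by
  have hinj' : Function.Injective a := fun j k h ↦ hinj (congrArg PadicInt.toZMod h)
  have h0 : p ^ n ≠ 0 := pow_ne_zero _ (Fact.out : p.Prime).ne_zero
  have h1 : PadicInt.toZModPow n (aeval (B : ℤ_[p]) f₁₂) = 0 := by
    rw [f₁₂, aeval_ofCoeffs, map_horner, map_natCast, ← cast_hornerMod h0, hf, Nat.cast_zero]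
  have hunit : IsUnit (∏ j ∈ Finset.univ.erase i, ((B : ℤ_[p]) - a j)) := by
    refine (Submonoid.prod_mem (IsUnit.submonoid _) fun j hj ↦ ?_)
    change IsUnit _
    by_contra h
    rw [← mem_nonunits_iff, PadicInt.mem_nonunits, ← PadicInt.toZMod_eq_zero_iff, map_sub,
      map_natCast, ← hB, sub_eq_zero] at h
    exact Finset.ne_of_mem_erase hj (hinj h).symm
  rw [aeval_eq_prod_sub hinj' ha, ← Finset.mul_prod_erase _ _ (Finset.mem_univ i), map_mul,
    (hunit.map (PadicInt.toZModPow n)).mul_left_eq_zero, map_sub, map_natCast, sub_eq_zero] at h1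
  exact h1.symm

end Padic

theorem ofFn_rootMod : List.ofFn rootMod = rootTable.map Prod.fst := by decide

theorem exists_refined_roots {r : ℕ} (h : precisionCheck r = true) : ∃ B : Fin 12 → ℕ,
    (∀ i, (B i : ZMod splitPrime) = rootMod i) ∧
    (∀ i, hornerMod (splitPrime ^ 2 ^ r) coeffs₁₂ (B i) = 0) ∧
    hexadSum (fun i ↦ (B i : ZMod (splitPrime ^ 2 ^ r))) = 228 := by
  rw [precisionCheck, force_eq] at h
  obtain ⟨L, hL⟩ := exists_newtonList_eq (α := Bool) r splitPrime rootTable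
  rw [hL] at h
  simp only [Bool.and_eq_true, beq_iff_eq, List.all_eq_true, Nat.beq_eq] at h
  obtain ⟨⟨⟨h1, h2⟩, h3⟩, h4⟩ := h
  obtain ⟨B, rfl⟩ : ∃ B : Fin 12 → ℕ, List.ofFn B = L :=
    ⟨fun i ↦ L[(i : ℕ)], List.ext_getElem (by simp [h1]) fun _ _ _ ↦ List.getElem_ofFn _⟩
  refine ⟨B, fun i ↦ ?_, fun i ↦ h3 _ (List.mem_ofFn.2 ⟨i, rfl⟩), ?_⟩
  · rw [← ofFn_rootMod, List.map_ofFn, List.ofFn_inj] at h2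
    have := congrFun h2 i
    rw [← this]
    exact (ZMod.natCast_mod _ _).symm
  · obtain ⟨c, hc, hc'⟩ := MultTree.exists_assign_eq (α := Bool) (splitPrime ^ 2 ^ r) 0 12
      (List.ofFn B) (by simp) hexadTree
    rw [hc] at h4
    have := hc' []
    rw [List.append_nil, List.map_ofFn] at this
    refine (this.trans (eval_hexadTree _)).symm.trans ?_
    change (((show ℕ from c) : ℕ) : ZMod (splitPrime ^ 2 ^ r)) = _
    rw [Nat.eq_of_beq_eq_true h4]
    rfl

theorem eq_one_of_hexadSum_rootMod {ρ : Equiv.Perm (Fin 12)}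
    (h : ∀ i : Fin 12, i < 5 → ρ i = i)
    (hρ : hexadSum (fun i ↦ (rootMod (ρ i) : ZMod splitPrime)) = 228) : ρ = 1 := by
  have hcheck := separationCheck_eq_true
  obtain ⟨t, ht, ht'⟩ := MultTree.exists_assign_eq (α := Bool) splitPrime 7 5
    ((rootTable.map Prod.fst).take 5) (by decide) hexadTree
  rw [separationCheck, ht] at hcheck
  have hlist : List.ofFn (fun i ↦ rootMod (ρ i)) = (rootTable.map Prod.fst).take 5 ++
      (List.ofFn (fun i ↦ rootMod (ρ i))).drop 5 := by
    have htake : (List.ofFn (fun i ↦ rootMod (ρ i))).take 5 = (List.ofFn rootMod).take 5 := by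
      simp [List.ofFn_succ, h]
    rw [← ofFn_rootMod, ← htake, List.take_append_drop]
  have hperm : ((List.ofFn (fun i ↦ rootMod (ρ i))).drop 5).Perm
      ((rootTable.map Prod.fst).drop 5) := by
    rw [← List.perm_append_left_iff ((rootTable.map Prod.fst).take 5), ← hlist,
      List.take_append_drop, ← ofFn_rootMod]
    exact Equiv.Perm.ofFn_comp_perm ρ rootMod
  have h228 := ht' (((List.ofFn (fun i ↦ rootMod (ρ i))).drop 5).map (↑))
  rw [← List.map_append, ← hlist, List.map_ofFn] at h228
  obtain ⟨-, heq⟩ := MultTree.eq_of_search hcheck (by decide) hperm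
    (h228.trans ((eval_hexadTree _).trans (by exact_mod_cast hρ)))
  rw [heq, List.take_append_drop, ← ofFn_rootMod, List.ofFn_inj] at hlist
  have hinj : Function.Injective rootMod := by decide
  exact Equiv.ext fun i ↦ hinj (congrFun hlist i)

theorem norm_le_of_aeval_f₁₂ {z : ℂ} (hz : aeval z f₁₂ = 0) : ‖z‖ ≤ 5 := by
  by_contra! h
  obtain ⟨s, hs, hs'⟩ : ∃ s : ℝ, 0 < s ∧ ‖z‖ = 5 + s := ⟨‖z‖ - 5, by linarith, by ring⟩
  have h1 : z ^ 12 = 12 * z ^ 10 + -8 * z ^ 9 + -21 * z ^ 8 + 36 * z ^ 7 + -192 * z ^ 6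
      + 240 * z ^ 5 + 84 * z ^ 4 + -68 * z ^ 3 + 72 * z ^ 2 + -48 * z + -5 := by
    rw [f₁₂_eq] at hz
    simp only [map_add, map_sub, map_mul, map_pow, aeval_X, map_ofNat] at hz
    linear_combination hz
  have h2 : ‖z‖ ^ 12 ≤ 12 * ‖z‖ ^ 10 + 8 * ‖z‖ ^ 9 + 21 * ‖z‖ ^ 8 + 36 * ‖z‖ ^ 7
      + 192 * ‖z‖ ^ 6 + 240 * ‖z‖ ^ 5 + 84 * ‖z‖ ^ 4 + 68 * ‖z‖ ^ 3 + 72 * ‖z‖ ^ 2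
      + 48 * ‖z‖ + 5 := by
    rw [← norm_pow, h1]
    repeat refine (norm_add_le _ _).trans (add_le_add ?_ ?_)
    all_goals simp
  rw [hs'] at h2
  have h3 : 0 < (5 + s) ^ 12 - (12 * (5 + s) ^ 10 + 8 * (5 + s) ^ 9 + 21 * (5 + s) ^ 8
      + 36 * (5 + s) ^ 7 + 192 * (5 + s) ^ 6 + 240 * (5 + s) ^ 5 + 84 * (5 + s) ^ 4
      + 68 * (5 + s) ^ 3 + 72 * (5 + s) ^ 2 + 48 * (5 + s) + 5) := by
    ring_nf
    positivity
  linarith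

theorem norm_hexadSum_le {v : Fin 12 → ℂ} (hv : ∀ i, ‖v i‖ ≤ 5) : ‖hexadSum v‖ ≤ 132 * 5 ^ 6 := by
  have hlist : ∀ l ∈ hexadList, l.Nodup ∧ l.length = 6 := by decide +kernel
  have hcard : ∀ S ∈ hexads, S.card = 6 := by
    intro S hS
    obtain ⟨l, hl, rfl⟩ := List.mem_map.1 (Multiset.mem_coe.1 hS)
    rw [List.toFinset_card_of_nodup (hlist l hl).1, (hlist l hl).2]
  have hlen : Multiset.card hexads = 132 := by
    rw [hexads, Multiset.coe_card, List.length_map]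
    decide +kernel
  have h : ∀ s : Multiset (Finset (Fin 12)), (∀ S ∈ s, S.card = 6) →
      ‖(s.map fun S ↦ ∏ i ∈ S, v i).sum‖ ≤ Multiset.card s * 5 ^ 6 := by
    intro s
    induction s using Multiset.induction_on with
    | empty => simp
    | cons S s ih =>
      intro hs
      rw [Multiset.map_cons, Multiset.sum_cons, Multiset.card_cons]
      have h1 : ‖∏ i ∈ S, v i‖ ≤ 5 ^ 6 := by
        rw [norm_prod, ← hs S (Multiset.mem_cons_self _ _)]
        exact (Finset.prod_le_prod (fun _ _ ↦ norm_nonneg _) fun i _ ↦ hv i).trans_eq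
          (Finset.prod_const _)
      have h2 := ih fun T hT ↦ hs T (Multiset.mem_cons_of_mem hT)
      push_cast
      linarith [norm_add_le (∏ i ∈ S, v i) (s.map fun S ↦ ∏ i ∈ S, v i).sum]
  have := h hexads hcard
  rw [hlen] at this
  exact_mod_cast this

/-- The values of `hexadSum` at the rearrangements of `v`, indexed by the cosets of `mathieu`. -/
def cosetSum {R : Type*} [CommRing R] (v : Fin 12 → R) : Equiv.Perm (Fin 12) ⧸ mathieu → R :=
  Quotient.lift (fun π ↦ hexadSum fun i ↦ v (π i)) fun π ρ h ↦ by
    have := hexadSum_comp (fun i ↦ v (π i)) (QuotientGroup.leftRel_apply.1 h)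
    simpa using this.symm

theorem cosetSum_mk {R : Type*} [CommRing R] (v : Fin 12 → R) (π : Equiv.Perm (Fin 12)) :
    cosetSum v (QuotientGroup.mk π) = hexadSum fun i ↦ v (π i) := rfl

theorem map_cosetSum {R S : Type*} [CommRing R] [CommRing S] (φ : R →+* S) (v : Fin 12 → R)
    (c : Equiv.Perm (Fin 12) ⧸ mathieu) : φ (cosetSum v c) = cosetSum (fun i ↦ φ (v i)) c := by
  obtain ⟨π, rfl⟩ := QuotientGroup.mk_surjective c
  exact map_hexadSum φ _

/-- The product of `cosetSum v - 228` over all cosets. -/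
noncomputable def resolventValue {R : Type*} [CommRing R] (v : Fin 12 → R) : R :=
  ∏ᶠ c, (cosetSum v c - 228)

theorem map_resolventValue {R S : Type*} [CommRing R] [CommRing S] (φ : R →+* S) (v : Fin 12 → R) :
    φ (resolventValue v) = resolventValue fun i ↦ φ (v i) := by
  have := Fintype.ofFinite (Equiv.Perm (Fin 12) ⧸ mathieu)
  simp only [resolventValue, finprod_eq_prod_of_fintype, map_prod, map_sub, map_cosetSum,
    map_ofNat]

theorem resolventValue_eq_zero_of_hexadSum {R : Type*} [CommRing R] {v : Fin 12 → R}
    (h : hexadSum v = 228) : resolventValue v = 0 := by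
  have := Fintype.ofFinite (Equiv.Perm (Fin 12) ⧸ mathieu)
  rw [resolventValue, finprod_eq_prod_of_fintype]
  exact Finset.prod_eq_zero (Finset.mem_univ (QuotientGroup.mk 1)) (sub_eq_zero.2 h)

theorem norm_resolventValue_le {v : Fin 12 → ℂ} (hv : ∀ i, aeval (v i) f₁₂ = 0) :
    ‖resolventValue v‖ ≤ (2 ^ 21) ^ mathieu.index := by
  have := Fintype.ofFinite (Equiv.Perm (Fin 12) ⧸ mathieu)
  rw [resolventValue, finprod_eq_prod_of_fintype, norm_prod, Subgroup.index,
    Nat.card_eq_fintype_card]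
  refine (Finset.prod_le_prod (fun _ _ ↦ norm_nonneg _) fun c _ ↦ ?_).trans_eq
    (Finset.prod_const _)
  obtain ⟨ρ, rfl⟩ := QuotientGroup.mk_surjective c
  rw [cosetSum_mk]
  refine (norm_sub_le _ _).trans ?_
  have h3 := norm_hexadSum_le fun i ↦ norm_le_of_aeval_f₁₂ (hv (ρ i))
  have h4 : ‖(228 : ℂ)‖ = 228 := by simp
  linarith

theorem two_pow_lt_splitPrime_pow : (2 ^ 21) ^ mathieu.index < splitPrime ^ 2 ^ 13 := by
  rw [index_mathieu]
  calc (2 ^ 21) ^ 5040 = 2 ^ (21 * 5040) := (pow_mul _ _ _).symm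
    _ ≤ 2 ^ (20 * 2 ^ 13) := Nat.pow_le_pow_right (by norm_num) (by norm_num)
    _ = (2 ^ 20) ^ 2 ^ 13 := pow_mul _ _ _
    _ < splitPrime ^ 2 ^ 13 := Nat.pow_lt_pow_left (by norm_num) (by norm_num)

section Galois

variable {L : Type*} [Field L] {r : Fin 12 → L}

theorem isIntegral_hexadSum (hr : ∀ i, aeval (r i) f₁₂ = 0) (π : Equiv.Perm (Fin 12)) :
    IsIntegral ℤ (hexadSum fun i ↦ r (π i)) := by
  refine IsIntegral.multiset_sum fun x hx ↦ ?_
  obtain ⟨S, -, rfl⟩ := Multiset.mem_map.1 hx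
  exact IsIntegral.prod _ fun i _ ↦ ⟨f₁₂, monic_f₁₂, hr (π i)⟩

theorem mem_mathieu_of_hexadSum {φ : L →+* ℚ_[splitPrime]} {a : Fin 12 → ℤ_[splitPrime]}
    (ha : ∀ i, φ (r i) = a i) (ha' : ∀ i, PadicInt.toZMod (a i) = rootMod i)
    {π : Equiv.Perm (Fin 12)} (h : hexadSum (fun i ↦ r (π i)) = 228) : π ∈ mathieu := by
  obtain ⟨m, hm, hm'⟩ := exists_mem_mathieu_firstFive_eq (firstFive π⁻¹)
  have h1 : π * m = 1 := by
    refine eq_one_of_hexadSum_rootMod (fun i hi ↦ ?_) ?_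
    · have : m i = π⁻¹ i := DFunLike.congr_fun hm' (⟨i, hi⟩ : Fin 5)
      rw [Equiv.Perm.mul_apply, this, ← Equiv.Perm.mul_apply, mul_inv_cancel, Equiv.Perm.one_apply]
    · rw [← hexadSum_comp _ hm] at h
      have h2 := congrArg φ h
      rw [map_hexadSum, map_ofNat] at h2
      simp only [ha] at h2
      have h3 : hexadSum (fun i ↦ a (π (m i))) = 228 := by
        refine Subtype.coe_injective ((map_hexadSum PadicInt.Coe.ringHom _).trans ?_)
        exact h2
      have h4 := congrArg PadicInt.toZMod h3
      rw [map_hexadSum, map_ofNat] at h4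
      simp only [ha'] at h4
      exact h4
  rw [eq_inv_of_mul_eq_one_left h1]
  exact mathieu.inv_mem hm

variable [Algebra ℚ L]

theorem exists_perm_of_aeval_eq_zero (hinj : Function.Injective r)
    (hr : ∀ i, aeval (r i) f₁₂ = 0) (σ : L ≃ₐ[ℚ] L) :
    ∃ π : Equiv.Perm (Fin 12), ∀ i, σ (r i) = r (π i) := by
  have h : ∀ i, ∃ j, σ (r i) = r j := by
    intro i
    have h1 : aeval (σ (r i)) f₁₂ = 0 := by
      have := aeval_algHom_apply (σ.toAlgHom.restrictScalars ℤ) (r i) f₁₂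
      rw [hr i, map_zero] at this
      exact this
    rw [aeval_eq_prod_sub hinj hr, Finset.prod_eq_zero_iff] at h1
    obtain ⟨j, -, hj⟩ := h1
    exact ⟨j, sub_eq_zero.1 hj⟩
  choose g hg using h
  have hgi : Function.Injective g := fun i j hij ↦ hinj (σ.injective (by rw [hg, hg, hij]))
  exact ⟨Equiv.ofBijective g (Finite.injective_iff_bijective.1 hgi), hg⟩

/-- The Galois group of `L` as a group of permutations of the indices of the family `r`. -/
def galSubgroup (r : Fin 12 → L) : Subgroup (Equiv.Perm (Fin 12)) where
  carrier := {π | ∃ σ : L ≃ₐ[ℚ] L, ∀ i, σ (r i) = r (π i)}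
  one_mem' := ⟨1, fun _ ↦ rfl⟩
  mul_mem' := by
    rintro π ρ ⟨σ, hσ⟩ ⟨τ, hτ⟩
    exact ⟨σ * τ, fun i ↦ by rw [AlgEquiv.mul_apply, hτ, hσ]; rfl⟩
  inv_mem' := by
    rintro π ⟨σ, hσ⟩
    refine ⟨σ⁻¹, fun i ↦ σ.injective ?_⟩
    rw [hσ, ← AlgEquiv.mul_apply, mul_inv_cancel]
    simp

theorem exists_int_resolventValue [FiniteDimensional ℚ L] [IsGalois ℚ L]
    (hinj : Function.Injective r) (hr : ∀ i, aeval (r i) f₁₂ = 0) :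
    ∃ n : ℤ, resolventValue r = n := by
  have hint : IsIntegral ℤ (resolventValue r) := by
    refine finprod_induction (p := IsIntegral ℤ) isIntegral_one (fun _ _ ↦ IsIntegral.mul)
      fun c ↦ ?_
    obtain ⟨π, rfl⟩ := QuotientGroup.mk_surjective c
    exact (isIntegral_hexadSum hr π).sub
      (by simpa using isIntegral_algebraMap (R := ℤ) (x := 228) (A := L))
  have hfix : resolventValue r ∈ (⊥ : IntermediateField ℚ L) := by
    rw [IsGalois.mem_bot_iff_fixed]
    intro σ
    obtain ⟨π, hπ⟩ := exists_perm_of_aeval_eq_zero hinj hr σ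
    have h1 : ∀ c, σ (cosetSum r c) = cosetSum r (π • c) := by
      intro c
      obtain ⟨ρ, rfl⟩ := QuotientGroup.mk_surjective c
      rw [MulAction.Quotient.smul_mk, cosetSum_mk, cosetSum_mk]
      refine (map_hexadSum (σ : L →+* L) _).trans ?_
      simp [hπ]
    rw [resolventValue]
    have h2 := MonoidHom.map_finprod_of_preimage_one (σ : L →* L)
      (fun x hx ↦ σ.injective (hx.trans (map_one σ).symm)) fun c ↦ cosetSum r c - 228
    refine h2.trans ?_
    simp only [MonoidHom.coe_coe, map_sub, h1, map_ofNat]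
    exact finprod_comp_equiv (MulAction.toPerm π) (f := fun c ↦ cosetSum r c - 228)
  obtain ⟨q, hq⟩ := IntermediateField.mem_bot.1 hfix
  rw [← hq, isIntegral_algebraMap_iff (algebraMap ℚ L).injective] at hint
  obtain ⟨n, rfl⟩ := IsIntegrallyClosed.isIntegral_iff.1 hint
  exact ⟨n, by rw [← hq]; simp⟩

theorem hexadSum_eq [FiniteDimensional ℚ L] [IsGalois ℚ L] (hinj : Function.Injective r)
    (hr : ∀ i, aeval (r i) f₁₂ = 0) {φ : L →+* ℚ_[splitPrime]} {a : Fin 12 → ℤ_[splitPrime]}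
    (ha : ∀ i, φ (r i) = a i) (ha' : ∀ i, PadicInt.toZMod (a i) = rootMod i) {k : ℕ}
    (hk : (2 ^ 21) ^ mathieu.index < splitPrime ^ k)
    (h : PadicInt.toZModPow k (hexadSum a) = 228) : hexadSum r = 228 := by
  obtain ⟨n, hn⟩ := exists_int_resolventValue hinj hr
  have hle : |n| ≤ (2 ^ 21) ^ mathieu.index := by
    obtain ⟨ψ⟩ : Nonempty (L →ₐ[ℚ] ℂ) := ⟨IsAlgClosed.lift⟩
    have h1 := norm_resolventValue_le (v := fun i ↦ ψ (r i)) fun i ↦ by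
      have := aeval_algHom_apply (ψ.restrictScalars ℤ) (r i) f₁₂
      rw [hr, map_zero] at this
      exact this
    have h2 : resolventValue (fun i ↦ ψ (r i)) = n :=
      (map_resolventValue (ψ : L →+* ℂ) r).symm.trans (by rw [hn, map_intCast])
    rw [h2, Complex.norm_intCast] at h1
    exact_mod_cast h1
  have hdvd : ((splitPrime ^ k : ℕ) : ℤ) ∣ n := by
    have h1 : (n : ℤ_[splitPrime]) = resolventValue a := by
      refine Subtype.coe_injective ((map_intCast PadicInt.Coe.ringHom n).trans
        (Eq.trans ?_ (map_resolventValue PadicInt.Coe.ringHom a).symm))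
      rw [← map_intCast φ, ← hn, map_resolventValue]
      simp only [ha]
      rfl
    rw [map_hexadSum] at h
    rw [← ZMod.intCast_zmod_eq_zero_iff_dvd, ← map_intCast (PadicInt.toZModPow k), h1,
      map_resolventValue, resolventValue_eq_zero_of_hexadSum h]
  have hzero : n = 0 := by
    refine Int.eq_zero_of_abs_lt_dvd hdvd (hle.trans_lt ?_)
    exact_mod_cast hk
  have := Fintype.ofFinite (Equiv.Perm (Fin 12) ⧸ mathieu)
  rw [hzero, Int.cast_zero, resolventValue, finprod_eq_prod_of_fintype,
    Finset.prod_eq_zero_iff] at hn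
  obtain ⟨c, -, hc⟩ := hn
  obtain ⟨π, rfl⟩ := QuotientGroup.mk_surjective c
  rw [cosetSum_mk, sub_eq_zero] at hc
  rw [← hc, hexadSum_comp r (mem_mathieu_of_hexadSum ha ha' hc)]

theorem galSubgroup_le_mathieu [FiniteDimensional ℚ L] [IsGalois ℚ L]
    (hinj : Function.Injective r) (hr : ∀ i, aeval (r i) f₁₂ = 0)
    {φ : L →+* ℚ_[splitPrime]} {a : Fin 12 → ℤ_[splitPrime]} (ha : ∀ i, φ (r i) = a i)
    (ha' : ∀ i, PadicInt.toZMod (a i) = rootMod i) : galSubgroup r ≤ mathieu := by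
  have hrootMod : Function.Injective fun i ↦ PadicInt.toZMod (a i) := by
    simp only [ha']
    decide
  have ha₀ : ∀ i, aeval (a i) f₁₂ = 0 := by
    intro i
    have := aeval_algHom_apply (φ.toIntAlgHom) (r i) f₁₂
    rw [hr i, map_zero] at this
    refine Subtype.coe_injective ((aeval_algHom_apply PadicInt.Coe.ringHom.toIntAlgHom
      (a i) f₁₂).symm.trans ?_)
    exact (congrArg (fun x ↦ aeval x f₁₂) (ha i).symm).trans this
  obtain ⟨B, hB, hB', hB₂⟩ := exists_refined_roots precisionCheck_eq_true
  have h228 : hexadSum r = 228 := by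
    refine hexadSum_eq hinj hr ha ha' two_pow_lt_splitPrime_pow ?_
    rw [map_hexadSum]
    simp only [fun i ↦ toZModPow_eq_of_hornerMod_eq_zero ha₀ hrootMod
      ((ha' i).trans (hB i).symm) (hB' i)]
    exact hB₂
  rintro π ⟨σ, hσ⟩
  refine mem_mathieu_of_hexadSum ha ha' ?_
  simp only [← hσ]
  exact (map_hexadSum (σ : L →+* L) r).symm.trans (by rw [h228, map_ofNat])

end Galois

/-- The splitting field of `f₁₂` contains its roots, and embeds into the `splitPrime`-adic numbers. -/
theorem exists_padic_embedding (L : Type*) [Field L] [Algebra ℚ L]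
    [(f₁₂.map (algebraMap ℤ ℚ)).IsSplittingField ℚ L] :
    ∃ (r : Fin 12 → L) (φ : L →+* ℚ_[splitPrime]) (a : Fin 12 → ℤ_[splitPrime]),
      Function.Injective r ∧ (∀ i, aeval (r i) f₁₂ = 0) ∧ (∀ i, φ (r i) = a i) ∧
      ∀ i, PadicInt.toZMod (a i) = rootMod i := by
  have h1 : ∀ i, hornerMod splitPrime coeffs₁₂ (rootMod i) = 0 ∧
      hornerMod splitPrime derivCoeffs₁₂ (rootMod i) % splitPrime ≠ 0 := by decide +kernel
  choose a ha ha' using fun i ↦ exists_padicInt_root (h1 i).1 (h1 i).2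
  have hinj : Function.Injective a := by
    have h2 : Function.Injective fun i ↦ (rootMod i : ZMod splitPrime) := by decide
    exact fun i j hij ↦ h2 (by simp only [← ha', hij])
  have hinj' : Function.Injective fun i ↦ (a i : ℚ_[splitPrime]) :=
    Subtype.coe_injective.comp hinj
  have ha₂ : ∀ i, aeval (a i : ℚ_[splitPrime]) f₁₂ = 0 := fun i ↦
    (aeval_algHom_apply PadicInt.Coe.ringHom.toIntAlgHom (a i) f₁₂).trans
      (by rw [ha, map_zero])
  have hprod := eq_prod_X_sub_C_of_aeval_eq_zero monic_f₁₂ natDegree_f₁₂ hinj' ha₂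
  have hsplit : ((f₁₂.map (algebraMap ℤ ℚ)).map (algebraMap ℚ ℚ_[splitPrime])).Splits := by
    rw [map_map, ← IsScalarTower.algebraMap_eq, hprod]
    exact Splits.prod fun i _ ↦ Splits.X_sub_C _
  let φ : L →ₐ[ℚ] ℚ_[splitPrime] := IsSplittingField.lift L (f₁₂.map (algebraMap ℤ ℚ)) hsplit
  have hL := IsSplittingField.splits L (f₁₂.map (algebraMap ℤ ℚ))
  have hex : ∀ i, ∃ x : L, φ x = a i ∧ aeval x f₁₂ = 0 := by
    intro i
    have h2 : (((f₁₂.map (algebraMap ℤ ℚ)).map (algebraMap ℚ L)).map (φ : L →+* ℚ_[splitPrime])).IsRoot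
        (a i : ℚ_[splitPrime]) := by
      rw [map_map, map_map, RingHom.ext_int (((φ : L →+* ℚ_[splitPrime]).comp (algebraMap ℚ L)).comp
        (algebraMap ℤ ℚ)) (algebraMap ℤ _), IsRoot, eval_map_algebraMap, ha₂]
    obtain ⟨x, hx⟩ := hL.mem_range_of_isRoot ((monic_f₁₂.map _).map _).ne_zero h2
    refine ⟨x, hx, φ.injective ?_⟩
    have := aeval_algHom_apply (φ.restrictScalars ℤ) x f₁₂
    rw [map_zero, ← ha₂ i, ← hx]
    exact this.symm
  choose r hr hr' using hex
  exact ⟨r, φ, a, fun i j hij ↦ hinj' (by simp only [← hr, hij]), hr', hr, ha'⟩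

/-- At every prime number, some element of the Galois group acts on the roots of `f₁₂` in a field of
positive characteristic through the Frobenius map. -/
theorem exists_mem_galSubgroup_frobenius.{u} {L : Type u} [Field L] [NumberField L] [IsGalois ℚ L]
    {r : Fin 12 → L} (hinj : Function.Injective r) (hr : ∀ i, aeval (r i) f₁₂ = 0)
    {p : ℕ} (hp : p.Prime) :
    ∃ (k : Type u) (_ : Field k) (_ : CharP k p) (s : Fin 12 → k) (π : Equiv.Perm (Fin 12)),
      π ∈ galSubgroup r ∧ f₁₂.map (algebraMap ℤ k) = ∏ i, (X - C (s i)) ∧ ∀ i, s (π i) = s i ^ p := by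
  have hspan : (Ideal.span {(p : ℤ)}).IsMaximal :=
    PrincipalIdealRing.isMaximal_of_irreducible (Nat.prime_iff_prime_int.1 hp).irreducible
  obtain ⟨Q, hQ, ⟨hQp⟩⟩ := Ideal.exists_maximal_ideal_liesOver_of_isIntegral
    (S := NumberField.RingOfIntegers L) (Ideal.span {(p : ℤ)})
  have hmem (x : ℤ) : (x : NumberField.RingOfIntegers L) ∈ Q ↔ (p : ℤ) ∣ x := by
    rw [← Ideal.mem_span_singleton, hQp, Ideal.under_def, Ideal.mem_comap, eq_intCast]
  have hQ0 : Q ≠ ⊥ := by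
    rintro rfl
    have := (hmem p).2 dvd_rfl
    exact hp.ne_zero (by exact_mod_cast Ideal.mem_bot.1 this)
  have := Ideal.finiteQuotientOfFreeOfNeBot Q hQ0
  have := IsGaloisGroup.of_isFractionRing Gal(L/ℚ) ℤ (NumberField.RingOfIntegers L) ℚ L
  obtain ⟨σ, hσ⟩ := IsArithFrobAt.exists_of_isInvariant ℤ Gal(L/ℚ) Q
  have hcard : Nat.card (ℤ ⧸ Q.under ℤ) = p := by
    rw [← hQp]
    exact Int.card_ideal_quot p
  have hint : ∀ i, IsIntegral ℤ (r i) := fun i ↦ ⟨f₁₂, monic_f₁₂, hr i⟩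
  let R : Fin 12 → NumberField.RingOfIntegers L := fun i ↦ ⟨r i, hint i⟩
  have hR : ∀ i, aeval (R i) f₁₂ = 0 := fun i ↦ by
    refine NumberField.RingOfIntegers.ext ((aeval_algebraMap_apply L (R i) f₁₂).symm.trans ?_)
    exact (hr i).trans (map_zero _).symm
  have hRinj : Function.Injective R := fun i j h ↦ hinj (congrArg Subtype.val h)
  have hprod : f₁₂.map (algebraMap ℤ (NumberField.RingOfIntegers L ⧸ Q)) =
      ∏ i, (X - C (Ideal.Quotient.mk Q (R i))) := by
    have := congrArg (Polynomial.map (Ideal.Quotient.mk Q))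
      (eq_prod_X_sub_C_of_aeval_eq_zero monic_f₁₂ natDegree_f₁₂ hRinj hR)
    rw [map_map, RingHom.ext_int ((Ideal.Quotient.mk Q).comp _) (algebraMap ℤ _)] at this
    rw [this]
    simp [Polynomial.map_prod]
  let := Ideal.Quotient.field Q
  obtain ⟨π, hπ⟩ := exists_perm_of_aeval_eq_zero hinj hr σ
  refine ⟨NumberField.RingOfIntegers L ⧸ Q, inferInstance, ?_, fun i ↦ Ideal.Quotient.mk Q (R i), π,
    ⟨σ, hπ⟩, ?_, fun i ↦ ?_⟩
  · refine (charP_iff _ _).2 fun n ↦ ?_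
    rw [← map_natCast (Ideal.Quotient.mk Q), Ideal.Quotient.eq_zero_iff_mem, ← Int.cast_natCast,
      hmem, Int.natCast_dvd_natCast]
  · rw [← hprod]
    exact congrArg (Polynomial.map · f₁₂) (RingHom.ext_int _ _)
  · have h1 := hσ (R i)
    have h2 : MulSemiringAction.toAlgHom ℤ (NumberField.RingOfIntegers L) σ (R i) = R (π i) :=
      NumberField.RingOfIntegers.ext (hπ i)
    rw [h2, hcard, ← Ideal.Quotient.eq, map_pow] at h1
    exact h1

/-- Evaluation of the polynomial with given coefficients, in decreasing degree. -/
def evalDesc {R : Type*} [CommRing R] : List ℕ → R → R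
  | [], _ => 0
  | c :: l, x => c * x ^ l.length + evalDesc l x

theorem evalDesc_nil {R : Type*} [CommRing R] (x : R) : evalDesc [] x = 0 := rfl

theorem evalDesc_cons {R : Type*} [CommRing R] (c : ℕ) (l : List ℕ) (x : R) :
    evalDesc (c :: l) x = c * x ^ l.length + evalDesc l x := rfl

theorem evalDesc_append_singleton {R : Type*} [CommRing R] (l : List ℕ) (c : ℕ) (x : R) :
    evalDesc (l ++ [c]) x = evalDesc l x * x + c := by
  induction l with
  | nil => simp [evalDesc_cons, evalDesc_nil]
  | cons a l ih =>
    rw [List.cons_append, evalDesc_cons, ih, evalDesc_cons, List.length_append]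
    simp only [List.length_cons, List.length_nil]
    ring

theorem eq_zero_of_evalDesc_X_eq_zero {k : Type*} [Field k] (l : List ℕ)  :
    (evalDesc l (X : k[X])).degree < l.length ∧
      (evalDesc l (X : k[X]) = 0 → ∀ c ∈ l, (c : k) = 0) := by
  induction l with
  | nil => simp [evalDesc_nil]
  | cons c l ih =>
    rw [evalDesc_cons, ← C_eq_natCast]
    refine ⟨?_, fun h ↦ ?_⟩
    · refine (degree_add_le _ _).trans_lt (max_lt ?_ (ih.1.trans ?_))
      · refine (degree_C_mul_X_pow_le _ _).trans_lt ?_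
        exact_mod_cast Nat.lt_succ_self _
      · exact_mod_cast Nat.lt_succ_self _
    · have hc : (c : k) = 0 := by
        have := congrArg (coeff · l.length) h
        simpa [coeff_eq_zero_of_degree_lt ih.1] using this
      rw [hc, C_0, zero_mul, zero_add] at h
      exact List.forall_mem_cons.2 ⟨hc, ih.2 h⟩

theorem eq_zero_of_evalDesc_eq_zero {k : Type*} [Field k] {l : List ℕ} {s : Fin l.length → k}
    (hs : Function.Injective s) (h : ∀ i, evalDesc l (s i) = 0) : ∀ c ∈ l, (c : k) = 0 := by
  refine (eq_zero_of_evalDesc_X_eq_zero l).2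
    (eq_zero_of_degree_lt_of_eval_index_eq_zero Finset.univ hs.injOn ?_ ?_)
  · simpa using (eq_zero_of_evalDesc_X_eq_zero l).1
  · intro i _
    rw [← h i]
    have : ∀ l : List ℕ, eval (s i) (evalDesc l X) = evalDesc l (s i) := fun l ↦ by
      induction l with
      | nil => simp [evalDesc_nil]
      | cons c l ih => simp [evalDesc_cons, ih]
    exact this l

/-- The list of the sums `a + c * b` modulo `p`, for `a` and `b` in two given lists. -/
def addMulMod (p c : ℕ) (l l' : List ℕ) : List ℕ :=
  List.zipWith (fun a b ↦ Nat.mod (Nat.add a (Nat.mul c b)) p) l l'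

theorem evalDesc_addMulMod {R : Type*} [CommRing R] (p : ℕ) [CharP R p] (c : ℕ) (x : R) :
    ∀ l l' : List ℕ, l.length = l'.length →
      evalDesc (addMulMod p c l l') x = evalDesc l x + c * evalDesc l' x
  | [], [], _ => by simp [addMulMod, evalDesc_nil]
  | a :: l, b :: l', h => by
    rw [List.length_cons, List.length_cons, Nat.add_right_cancel_iff] at h
    have h1 : ((Nat.mod (Nat.add a (Nat.mul c b)) p : ℕ) : R) = a + c * b := by
      change (((a + c * b) % p : ℕ) : R) = _
      rw [← CharP.cast_eq_mod]
      push_cast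
      rfl
    have h2 := evalDesc_addMulMod p c x l l' h
    rw [addMulMod] at h2 ⊢
    rw [List.zipWith_cons_cons, evalDesc_cons, evalDesc_cons, evalDesc_cons, h1, h2,
      List.length_zipWith, h, min_self]
    ring

theorem length_addMulMod (p c : ℕ) (l l' : List ℕ) :
    (addMulMod p c l l').length = min l.length l'.length := List.length_zipWith ..

/-- Force the evaluation of a list of natural numbers before it is passed on. -/
def forceList {α : Type} : List ℕ → (List ℕ → α) → α
  | [], k => k []
  | a :: l, k => force a fun a ↦ forceList l fun l ↦ k (a :: l)

theorem forceList_eq {α : Type} (l : List ℕ) (k : List ℕ → α) : forceList l k = k l := by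
  induction l generalizing k with
  | nil => rfl
  | cons a l ih => rw [forceList, force_eq, ih]

/-- The coefficients of `X ^ 12 - f₁₂` modulo `p`, in decreasing degree. -/
def negTail (p : ℕ) : List ℕ :=
  ((coeffs₁₂.take 12).map fun c ↦ ((-c) % (p : ℤ)).toNat).reverse

/-- The coefficients of `X * a + c * b` modulo `p` and `f₁₂`. -/
def mulStep (p : ℕ) (g b : List ℕ) (c : ℕ) : List ℕ → List ℕ
  | [] => []
  | t :: l => addMulMod p c (addMulMod p t (l ++ [0]) g) b

/-- Apply `k` to the product modulo `p` and `f₁₂`. -/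
def mulModAux {α : Type} (p : ℕ) (g b : List ℕ) : List ℕ → List ℕ → (List ℕ → α) → α
  | [], acc, k => k acc
  | c :: a, acc, k => forceList (mulStep p g b c acc) fun acc ↦ mulModAux p g b a acc k

/-- Apply `k` to the product of two polynomials modulo `p` and `f₁₂`. -/
def mulMod {α : Type} (p : ℕ) (g a b : List ℕ) (k : List ℕ → α) : α :=
  mulModAux p g b a (List.replicate 12 0) k

/-- Apply `k` to the `n`-th power modulo `p` and `f₁₂`, where `n < 2 ^ d`. -/
def powMod {α : Type} (p : ℕ) (g a : List ℕ) : (d n : ℕ) → (List ℕ → α) → α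
  | 0, _, k => k (List.replicate 11 0 ++ [1])
  | d + 1, n, k => powMod p g a d (n / 2) fun b ↦ mulMod p g b b fun c ↦
      if n % 2 = 0 then k c else mulMod p g a c k

/-- Apply `k` to the `p ^ m`-th power modulo `p` and `f₁₂`. -/
def frobMod {α : Type} (p : ℕ) (g : List ℕ) : (m : ℕ) → List ℕ → (List ℕ → α) → α
  | 0, a, k => k a
  | m + 1, a, k => powMod p g a 10 p fun b ↦ frobMod p g m b k

section CharP

variable {k : Type*} [CommRing k] {p : ℕ} [CharP k p] {x : k}

theorem evalDesc_negTail (hp : p ≠ 0) (hx : aeval x f₁₂ = 0) : evalDesc (negTail p) x = x ^ 12 := by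
  have h : ∀ c : ℤ, ((c % (p : ℤ)).toNat : k) = c := fun c ↦ by
    rw [← Int.cast_natCast, Int.toNat_of_nonneg (Int.emod_nonneg _ (by exact_mod_cast hp)),
      CharP.intCast_eq_intCast k p]
    exact Int.mod_modEq _ _
  rw [f₁₂, aeval_ofCoeffs] at hx
  simp [horner, coeffs₁₂] at hx
  simp [negTail, coeffs₁₂, evalDesc_cons, evalDesc_nil, h]
  linear_combination -hx

/-- A list of twelve coefficients of a polynomial with the value `y` at `x`. -/
def Represents (x : k) (l : List ℕ) (y : k) : Prop := l.length = 12 ∧ evalDesc l x = y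

theorem evalDesc_replicate_zero {R : Type*} [CommRing R] (n : ℕ) (x : R) :
    evalDesc (List.replicate n 0) x = 0 := by
  induction n with
  | zero => rfl
  | succ n ih => rw [List.replicate_succ, evalDesc_cons, ih, Nat.cast_zero, zero_mul, zero_add]

theorem length_negTail (p : ℕ) : (negTail p).length = 12 := by
  simp [negTail, coeffs₁₂]

theorem Represents.mulStep (hp : p ≠ 0) (hx : aeval x f₁₂ = 0) {b l : List ℕ} {y z : k}
    (hb : Represents x b y) (hl : Represents x l z) (c : ℕ) :
    Represents x (mulStep p (negTail p) b c l) (x * z + c * y) := by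
  obtain ⟨hl, rfl⟩ := hl
  obtain ⟨hb, rfl⟩ := hb
  obtain _ | ⟨t, l⟩ := l
  · simp at hl
  rw [List.length_cons] at hl
  have h1 : (l ++ [0]).length = (negTail p).length := by simp [length_negTail]; omega
  have h2 : (addMulMod p t (l ++ [0]) (negTail p)).length = 12 := by
    simp [length_addMulMod, length_negTail]; omega
  refine ⟨?_, ?_⟩
  · rw [_root_.mulStep, length_addMulMod, h2, hb, min_self]
  · rw [_root_.mulStep, evalDesc_addMulMod p c x _ _ (h2.trans hb.symm),
      evalDesc_addMulMod p t x _ _ h1, evalDesc_append_singleton, evalDesc_negTail hp hx,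
      evalDesc_cons, show l.length = 11 by omega]
    push_cast
    ring

theorem exists_mulModAux_eq {α : Type} (hp : p ≠ 0) (hx : aeval x f₁₂ = 0) {b : List ℕ} {y : k}
    (hb : Represents x b y) (a l : List ℕ) (z : k) (hl : Represents x l z) :
    ∃ r, (∀ κ : List ℕ → α, mulModAux p (negTail p) b a l κ = κ r) ∧
      Represents x r (z * x ^ a.length + evalDesc a x * y) := by
  induction a generalizing l z with
  | nil => exact ⟨l, fun _ ↦ rfl, by simpa [evalDesc_nil] using hl⟩
  | cons c a ih =>
    obtain ⟨r, hr, hr'⟩ := ih _ _ (hb.mulStep hp hx hl c)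
    refine ⟨r, fun κ ↦ by rw [mulModAux, forceList_eq, hr], ?_⟩
    convert hr' using 1
    rw [evalDesc_cons, List.length_cons]
    ring

theorem exists_mulMod_eq {α : Type} (hp : p ≠ 0) (hx : aeval x f₁₂ = 0) {a b : List ℕ} {y z : k}
    (ha : Represents x a z) (hb : Represents x b y) :
    ∃ r, (∀ κ : List ℕ → α, mulMod p (negTail p) a b κ = κ r) ∧ Represents x r (z * y) := by
  obtain ⟨r, hr, hr'⟩ := exists_mulModAux_eq (α := α) hp hx hb a (List.replicate 12 0) 0
    ⟨List.length_replicate, evalDesc_replicate_zero 12 x⟩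
  exact ⟨r, hr, by rwa [zero_mul, zero_add, ha.2] at hr'⟩

theorem exists_powMod_eq {α : Type} (hp : p ≠ 0) (hx : aeval x f₁₂ = 0) {a : List ℕ} {y : k}
    (ha : Represents x a y) (d n : ℕ) (hn : n < 2 ^ d) :
    ∃ r, (∀ κ : List ℕ → α, powMod p (negTail p) a d n κ = κ r) ∧ Represents x r (y ^ n) := by
  induction d generalizing n with
  | zero =>
    obtain rfl : n = 0 := by simpa using hn
    exact ⟨_, fun _ ↦ rfl, by simp, by
      rw [evalDesc_append_singleton, evalDesc_replicate_zero]; simp⟩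
  | succ d ih =>
    obtain ⟨b, hb, hb'⟩ := ih (n / 2) (by omega)
    obtain ⟨c, hc, hc'⟩ := exists_mulMod_eq (α := α) hp hx hb' hb'
    rw [← pow_add] at hc'
    obtain h | h := Nat.mod_two_eq_zero_or_one n
    · refine ⟨c, fun κ ↦ by rw [powMod, hb, hc, if_pos h], ?_⟩
      rwa [show n / 2 + n / 2 = n by omega] at hc'
    · obtain ⟨e, he, he'⟩ := exists_mulMod_eq (α := α) hp hx ha hc'
      refine ⟨e, fun κ ↦ by rw [powMod, hb, hc, if_neg (by omega), he], ?_⟩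
      rwa [← pow_succ', show n / 2 + n / 2 + 1 = n by omega] at he'

theorem exists_frobMod_eq {α : Type} (hp : p ≠ 0) (hp' : p < 2 ^ 10) (hx : aeval x f₁₂ = 0)
    (m : ℕ) {a : List ℕ} {y : k} (ha : Represents x a y) :
    ∃ r, (∀ κ : List ℕ → α, frobMod p (negTail p) m a κ = κ r) ∧ Represents x r (y ^ p ^ m) := by
  induction m generalizing a y with
  | zero => exact ⟨a, fun _ ↦ rfl, by simpa using ha⟩
  | succ m ih =>
    obtain ⟨b, hb, hb'⟩ := exists_powMod_eq (α := α) hp hx ha 10 p hp'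
    obtain ⟨r, hr, hr'⟩ := ih hb'
    exact ⟨r, fun κ ↦ by rw [frobMod, hb, hr], by rwa [pow_succ', pow_mul]⟩

end CharP

/-- The coefficients of the derivative of `f₁₂` modulo `p`, in decreasing degree. -/
def derivDesc (p : ℕ) : List ℕ :=
  (derivCoeffs₁₂.map fun c ↦ (c % (p : ℤ)).toNat).reverse

/-- Whether modulo `p` the list `u` represents the inverse of the derivative of `f₁₂`, the elements
of `c` are roots of `f₁₂`, and `X` is fixed by the `m`-th but not by the `n`-th power of the
Frobenius map. -/
def frobCheck (p m n : ℕ) (u c : List ℕ) : Bool :=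
  Nat.blt p 1024 && Nat.beq u.length 12 &&
  mulMod p (negTail p) u (derivDesc p) (fun l ↦ l == List.replicate 11 0 ++ [1]) &&
  frobMod p (negTail p) m (List.replicate 10 0 ++ [1, 0])
    (fun l ↦ l == List.replicate 10 0 ++ [1, 0]) &&
  frobMod p (negTail p) n (List.replicate 10 0 ++ [1, 0])
    (fun l ↦ (addMulMod p (p - 1) (List.replicate 10 0 ++ [1, 0]) l).any
      fun a ↦ !Nat.beq (a % p) 0) &&
  c.all fun b ↦ Nat.beq (hornerMod p coeffs₁₂ b) 0

theorem evalDesc_derivDesc {k : Type*} [CommRing k] {p : ℕ} [CharP k p] (hp : p ≠ 0) (x : k) :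
    evalDesc (derivDesc p) x = aeval x (derivative f₁₂) := by
  have h : ∀ c : ℤ, ((c % (p : ℤ)).toNat : k) = c := fun c ↦ by
    rw [← Int.cast_natCast, Int.toNat_of_nonneg (Int.emod_nonneg _ (by exact_mod_cast hp)),
      CharP.intCast_eq_intCast k p]
    exact Int.mod_modEq _ _
  rw [derivative_f₁₂, aeval_ofCoeffs]
  simp only [derivDesc, derivCoeffs₁₂, evalDesc_cons, evalDesc_nil, h, List.map_cons, List.map_nil,
    List.reverse_cons, List.reverse_nil, List.nil_append, List.cons_append, List.length_cons,
    List.length_nil, horner, List.foldr_cons, List.foldr_nil]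
  ring

theorem represents_X {k : Type*} [CommRing k] (x : k) :
    Represents x (List.replicate 10 0 ++ [1, 0]) x :=
  ⟨by simp, by simp [List.replicate_succ, evalDesc_cons, evalDesc_nil]⟩

theorem injective_of_aeval_derivative_ne_zero {k : Type*} [Field k] {s : Fin 12 → k}
    (hs : f₁₂.map (algebraMap ℤ k) = ∏ i, (X - C (s i)))
    (h : ∀ i, aeval (s i) (derivative f₁₂) ≠ 0) : Function.Injective s := by
  intro i j hij
  by_contra hne
  refine h i ?_
  rw [← eval_map_algebraMap, ← derivative_map, hs, ← Finset.mul_prod_erase _ _ (Finset.mem_univ i),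
    ← Finset.mul_prod_erase _ _ (Finset.mem_erase.2 ⟨Ne.symm hne, Finset.mem_univ j⟩)]
  simp [hij]

theorem exists_mem_galSubgroup_of_frobCheck {L : Type*} [Field L] [NumberField L] [IsGalois ℚ L]
    {r : Fin 12 → L} (hinj : Function.Injective r) (hr : ∀ i, aeval (r i) f₁₂ = 0)
    {p : ℕ} (hp : p.Prime) {m n : ℕ} {u c : List ℕ} (h : frobCheck p m n u c = true) :
    ∃ π ∈ galSubgroup r, π ^ m = 1 ∧ π ^ n ≠ 1 ∧ ∃ j : ℕ → Fin 12, ∀ b ∈ c, π (j b) = j b ∧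
      ∀ b' ∈ c, j b = j b' → b ≡ b' [MOD p] := by
  obtain ⟨k, _, _, s, π, hπ, hs, hsπ⟩ := exists_mem_galSubgroup_frobenius hinj hr hp
  simp only [frobCheck, Bool.and_eq_true, Nat.blt_eq, Nat.beq_eq, List.all_eq_true] at h
  obtain ⟨⟨⟨⟨⟨hp', hu⟩, h1⟩, h2⟩, h3⟩, h4⟩ := h
  have hs₀ : ∀ i, aeval (s i) f₁₂ = 0 := fun i ↦ by
    rw [← eval_map_algebraMap, hs, eval_prod]
    exact Finset.prod_eq_zero (Finset.mem_univ i) (by simp)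
  have hdesc (l : List ℕ) (i) : evalDesc l s i = evalDesc l (s i) := by
    induction l with
    | nil => rfl
    | cons c l ih => simp [evalDesc_cons, ih]
  have hx : aeval s f₁₂ = 0 := funext fun i ↦
    (aeval_algHom_apply (Pi.evalAlgHom ℤ (fun _ : Fin 12 ↦ k) i) s f₁₂).symm.trans (hs₀ i)
  have hsinj : Function.Injective s := by
    refine injective_of_aeval_derivative_ne_zero hs fun i hi ↦ ?_
    obtain ⟨l, hl, -, hl'⟩ := exists_mulMod_eq (α := Bool) hp.ne_zero hx ⟨hu, rfl⟩
      (b := derivDesc p) ⟨by simp [derivDesc, derivCoeffs₁₂], rfl⟩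
    rw [hl, beq_iff_eq] at h1
    have h5 := congrFun hl' i
    rw [Pi.mul_apply, hdesc (derivDesc p), evalDesc_derivDesc hp.ne_zero, hi, mul_zero, h1, hdesc] at h5
    simp [List.replicate_succ, evalDesc_cons, evalDesc_nil] at h5
  have hpow (m : ℕ) (i) : s ((π ^ m) i) = s i ^ p ^ m := by
    induction m with
    | zero => simp
    | succ m ih => rw [pow_succ', Equiv.Perm.mul_apply, hsπ, ih, ← pow_mul, ← pow_succ]
  refine ⟨π, hπ, ?_, fun hn ↦ ?_, ?_⟩
  · obtain ⟨l, hl, -, hl'⟩ := exists_frobMod_eq (α := Bool) hp.ne_zero hp' hx m (represents_X s)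
    rw [hl, beq_iff_eq] at h2
    rw [h2, (represents_X s).2] at hl'
    exact Equiv.ext fun i ↦ hsinj ((hpow m i).trans (congrFun hl' i).symm)
  · obtain ⟨l, hl, hlen, hl'⟩ :=
      exists_frobMod_eq (α := Bool) hp.ne_zero hp' hx n (represents_X s)
    rw [hl, List.any_eq_true] at h3
    obtain ⟨a, ha, ha'⟩ := h3
    have hzero : evalDesc (addMulMod p (p - 1) (List.replicate 10 0 ++ [1, 0]) l) s = 0 := by
      rw [evalDesc_addMulMod p _ _ _ _ (by simp [hlen]), (represents_X s).2, hl',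
        Nat.cast_sub hp.one_le, CharP.cast_eq_zero]
      funext i
      simp [← hpow, hn]
    have hlen' : (addMulMod p (p - 1) (List.replicate 10 0 ++ [1, 0]) l).length = 12 := by
      simp [length_addMulMod, hlen]
    have := eq_zero_of_evalDesc_eq_zero (k := k) (s := s ∘ Fin.cast hlen')
      (hsinj.comp (Fin.cast_injective _)) (fun i ↦ by
        rw [Function.comp_apply, ← hdesc, hzero, Pi.zero_apply]) a ha
    rw [CharP.cast_eq_zero_iff k p] at this
    simp [Nat.mod_eq_zero_of_dvd this] at ha'
  · have h5 : ∀ b : ℕ, ∃ j, b ∈ c → s j = b := by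
      intro b
      by_cases hb : b ∈ c
      · have h6 : aeval (b : k) f₁₂ = 0 := by
          have h7 := cast_hornerMod hp.ne_zero coeffs₁₂ b
          rw [h4 b hb] at h7
          have h8 := congrArg (ZMod.castHom (dvd_refl p) k) h7
          rw [map_horner, map_natCast, map_natCast, Nat.cast_zero] at h8
          rw [f₁₂, aeval_ofCoeffs, h8]
        rw [← eval_map_algebraMap, hs, eval_prod, Finset.prod_eq_zero_iff] at h6
        obtain ⟨j, -, hj⟩ := h6
        rw [eval_sub, eval_X, eval_C, sub_eq_zero] at hj
        exact ⟨j, fun _ ↦ hj.symm⟩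
      · exact ⟨0, fun h ↦ absurd h hb⟩
    choose j hj using h5
    refine ⟨j, fun b hb ↦ ⟨hsinj ?_, fun b' hb' hbb' ↦ ?_⟩⟩
    · have : Fact p.Prime := ⟨hp⟩
      rw [hsπ, hj b hb, ← frobenius_def, map_natCast]
    · rw [← CharP.natCast_eq_natCast k p, ← hj b hb, hbb', hj b' hb']

theorem frobCheck_five : frobCheck 5 11 1 [4, 2, 4, 1, 1, 0, 2, 4, 3, 1, 3, 2] [0] = true := by
  decide +kernel

theorem frobCheck_seven :
    frobCheck 7 5 1 [1, 5, 0, 2, 3, 2, 1, 4, 5, 3, 5, 3] [4, 6] = true := by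
  decide +kernel

theorem frobCheck_seventeen :
    frobCheck 17 8 4 [11, 14, 9, 0, 10, 1, 0, 16, 2, 14, 5, 1] [6, 10] = true := by
  decide +kernel

theorem frobCheck_fiveHundredTwentyThree :
    frobCheck 523 3 1 [447, 271, 405, 1, 140, 305, 191, 242, 438, 13, 444, 508] [118, 403] =
      true := by
  decide +kernel

theorem exists_mem_galSubgroup_orderOf {L : Type*} [Field L] [NumberField L] [IsGalois ℚ L]
    {r : Fin 12 → L} (hinj : Function.Injective r) (hr : ∀ i, aeval (r i) f₁₂ = 0) :
    ∀ n ∈ [8, 5, 3], ∃ g ∈ galSubgroup r, ∃ i j, i ≠ j ∧ g i = i ∧ g j = j ∧ orderOf g = n := by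
  have key : ∀ {p : ℕ} (_ : p.Prime) {q m b b' : ℕ} {u : List ℕ} (_ : q.Prime)
      (_ : frobCheck p (q ^ (m + 1)) (q ^ m) u [b, b'] = true) (_ : ¬ b ≡ b' [MOD p]),
      ∃ g ∈ galSubgroup r, ∃ i j, i ≠ j ∧ g i = i ∧ g j = j ∧ orderOf g = q ^ (m + 1) := by
    intro p hp q m b b' u hq h hb
    obtain ⟨π, hπ, h1, h2, j, hj⟩ := exists_mem_galSubgroup_of_frobCheck hinj hr hp h
    have := Fact.mk hq
    exact ⟨π, hπ, j b, j b', fun h ↦ hb ((hj b (by simp)).2 b' (by simp) h), (hj b (by simp)).1,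
      (hj b' (by simp)).1, orderOf_eq_prime_pow h2 h1⟩
  simp only [List.forall_mem_cons, List.not_mem_nil, false_imp_iff, implies_true, and_true]
  exact ⟨key (by norm_num) (q := 2) (m := 2) (by norm_num) frobCheck_seventeen (by decide),
    key (by norm_num) (q := 5) (m := 0) (by norm_num) frobCheck_seven (by decide),
    key (by norm_num) (q := 3) (m := 0) (by norm_num) frobCheck_fiveHundredTwentyThree (by decide)⟩

theorem exists_mem_galSubgroup_orderOf_eq_eleven {L : Type*} [Field L] [NumberField L]
    [IsGalois ℚ L] {r : Fin 12 → L} (hinj : Function.Injective r)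
    (hr : ∀ i, aeval (r i) f₁₂ = 0) : ∃ g ∈ galSubgroup r, ∃ i, g i = i ∧ orderOf g = 11 := by
  obtain ⟨π, hπ, h1, h2, j, hj⟩ :=
    exists_mem_galSubgroup_of_frobCheck hinj hr (by norm_num) frobCheck_five
  have : Fact (Nat.Prime 11) := ⟨by norm_num⟩
  exact ⟨π, hπ, j 0, (hj 0 (by simp)).1, orderOf_eq_prime h1 (by simpa using h2)⟩

theorem exists_mem_galSubgroup_apply_ne {L : Type*} [Field L] [NumberField L] [IsGalois ℚ L]
    {r : Fin 12 → L} (hinj : Function.Injective r) (hr : ∀ i, aeval (r i) f₁₂ = 0) (i : Fin 12) :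
    ∃ g ∈ galSubgroup r, g i ≠ i := by
  by_contra! h
  have hfix : r i ∈ (⊥ : IntermediateField ℚ L) := by
    rw [IsGalois.mem_bot_iff_fixed]
    intro σ
    obtain ⟨π, hπ⟩ := exists_perm_of_aeval_eq_zero hinj hr σ
    rw [hπ, h π ⟨σ, hπ⟩]
  obtain ⟨q, hq⟩ := IntermediateField.mem_bot.1 hfix
  have hint : IsIntegral ℤ (algebraMap ℚ L q) := ⟨f₁₂, monic_f₁₂, hq ▸ hr i⟩
  rw [isIntegral_algebraMap_iff (algebraMap ℚ L).injective] at hint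
  obtain ⟨n, rfl⟩ := IsIntegrallyClosed.isIntegral_iff.1 hint
  have h0 : aeval n f₁₂ = 0 := by
    refine (algebraMap ℤ L).injective_int ?_
    rw [← aeval_algebraMap_apply, map_zero, ← hr i, ← hq]
    simp
  have h2 := congrArg (Int.cast : ℤ → ZMod 2) h0
  rw [f₁₂, aeval_ofCoeffs, ← eq_intCast (Int.castRingHom (ZMod 2)), map_horner] at h2
  have : ∀ x : ZMod 2, horner coeffs₁₂ x ≠ 0 := by decide
  exact this _ (h2.trans Int.cast_zero)

section SplittingField

variable {L : Type*} [Field L] [Algebra ℚ L]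

theorem natCard_galSubgroup [(f₁₂.map (algebraMap ℤ ℚ)).IsSplittingField ℚ L] {r : Fin 12 → L}
    (hinj : Function.Injective r) (hr : ∀ i, aeval (r i) f₁₂ = 0) :
    Nat.card (galSubgroup r) = Nat.card Gal(L/ℚ) := by
  choose p hp using exists_perm_of_aeval_eq_zero hinj hr
  refine (Nat.card_congr (Equiv.ofBijective (fun σ ↦ (⟨p σ, σ, hp σ⟩ : galSubgroup r))
    ⟨fun σ τ h ↦ ?_, fun ⟨π, σ, hσ⟩ ↦ ⟨σ, ?_⟩⟩)).symm
  · have h' : p σ = p τ := congrArg Subtype.val h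
    have : (σ : L →ₐ[ℚ] L) = τ := by
      refine AlgHom.ext_of_adjoin_eq_top
        (IsSplittingField.adjoin_rootSet L (f₁₂.map (algebraMap ℤ ℚ))) fun x hx ↦ ?_
      have h0 := aeval_eq_zero_of_mem_rootSet hx
      rw [aeval_map_algebraMap, aeval_eq_prod_sub hinj hr, Finset.prod_eq_zero_iff] at h0
      obtain ⟨i, -, hi⟩ := h0
      rw [sub_eq_zero.1 hi]
      exact (hp σ i).trans ((congrArg (fun π ↦ r (π i)) h').trans (hp τ i).symm)
    exact AlgEquiv.ext fun x ↦ DFunLike.congr_fun this x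
  · exact Subtype.ext (Equiv.ext fun i ↦ hinj ((hp σ i).symm.trans (hσ i)))

theorem irreducible_of_isPretransitive {r : Fin 12 → L} (hinj : Function.Injective r)
    (hr : ∀ i, aeval (r i) f₁₂ = 0) (h : ∀ j, ∃ g ∈ galSubgroup r, g 0 = j) :
    Irreducible (f₁₂.map (algebraMap ℤ ℚ)) := by
  have hf : (f₁₂.map (algebraMap ℤ ℚ)).Monic := monic_f₁₂.map _
  have h0 : aeval (r 0) (f₁₂.map (algebraMap ℤ ℚ)) = 0 := by rw [aeval_map_algebraMap, hr]
  have hint : IsIntegral ℚ (r 0) := ⟨_, hf, h0⟩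
  have heq : f₁₂.map (algebraMap ℤ ℚ) = minpoly ℚ (r 0) := by
    refine eq_of_monic_of_dvd_of_natDegree_le (minpoly.monic hint) hf (minpoly.dvd _ _ h0) ?_
    rw [monic_f₁₂.natDegree_map, natDegree_f₁₂]
    by_contra! hlt
    refine (minpoly.monic hint).map (algebraMap ℚ L) |>.ne_zero
      (eq_zero_of_natDegree_lt_card_of_eval_eq_zero _ hinj (fun j ↦ ?_) ?_)
    · obtain ⟨g, ⟨σ, hσ⟩, rfl⟩ := h j
      rw [← hσ, eval_map_algebraMap]
      have := aeval_algHom_apply (σ : L →ₐ[ℚ] L) (r 0) (minpoly ℚ (r 0))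
      rw [minpoly.aeval, map_zero] at this
      exact this
    · rwa [(minpoly.monic hint).natDegree_map, Fintype.card_fin]
  rw [heq]
  exact minpoly.irreducible hint

end SplittingField

theorem irreducible_f₁₂_and_natCard_gal : Irreducible (f₁₂.map (algebraMap ℤ ℚ)) ∧
    Nat.card (f₁₂.map (algebraMap ℤ ℚ)).Gal = 95040 := by
  let L := (f₁₂.map (algebraMap ℤ ℚ)).SplittingField
  have : (f₁₂.map (algebraMap ℤ ℚ)).IsSplittingField ℚ L := IsSplittingField.splittingField _
  have : IsGalois ℚ L :=
    { to_normal := Normal.of_isSplittingField (f₁₂.map (algebraMap ℤ ℚ)) }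
  have : NumberField L := { }
  obtain ⟨r, φ, a, hinj, hr, ha, ha'⟩ := exists_padic_embedding L
  have hmove := exists_mem_galSubgroup_apply_ne hinj hr
  have h11 := exists_mem_galSubgroup_orderOf_eq_eleven hinj hr
  refine ⟨irreducible_of_isPretransitive hinj hr fun j ↦ ?_, ?_⟩
  · obtain ⟨j', hj'⟩ := exists_ne j
    obtain ⟨g, hg, hgj, -⟩ := exists_mem_pair_eq hmove h11 (zero_ne_one (α := Fin 12)) hj'.symm
    exact ⟨g, hg, hgj⟩
  · exact (natCard_galSubgroup hinj hr).symm.trans (card_eq_of_le_mathieu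
      (galSubgroup_le_mathieu hinj hr ha ha')
      (dvd_card_of_fixed_points hmove h11 (exists_mem_galSubgroup_orderOf hinj hr)))

/-- The coefficientwise sum `l + c • l'`. -/
def addMulCoeffs (c : ℤ) : List ℤ → List ℤ → List ℤ
  | l, [] => l
  | [], b :: l' => c * b :: addMulCoeffs c [] l'
  | a :: l, b :: l' => (a + c * b) :: addMulCoeffs c l l'

theorem horner_cons {R : Type*} [CommRing R] (c : ℤ) (l : List ℤ) (x : R) :
    horner (c :: l) x = c + x * horner l x := rfl

theorem horner_addMulCoeffs {R : Type*} [CommRing R] (c : ℤ) (l l' : List ℤ) (x : R) :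
    horner (addMulCoeffs c l l') x = horner l x + c * horner l' x := by
  induction l, l' using addMulCoeffs.induct with
  | case1 l => simp [addMulCoeffs, horner]
  | case2 b l' ih =>
    rw [addMulCoeffs, horner_cons, ih, horner_cons]
    push_cast [horner]
    simp
    ring
  | case3 a l b l' ih =>
    rw [addMulCoeffs, horner_cons, ih, horner_cons, horner_cons]
    push_cast
    ring

/-- The coefficients of the product with the derivative of `f₁₂`, reduced modulo `f₁₂`. -/
def mulDeriv (l : List ℤ) : List ℤ :=
  l.foldr (fun c v ↦ addMulCoeffs c (addMulCoeffs (-v.getD 11 0) (0 :: v) coeffs₁₂) derivCoeffs₁₂) []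

theorem horner_mulDeriv {R : Type*} [CommRing R] {x : R} (hx : horner coeffs₁₂ x = 0) (l : List ℤ) :
    horner (mulDeriv l) x = horner derivCoeffs₁₂ x * horner l x := by
  induction l with
  | nil => simp [mulDeriv, horner]
  | cons c l ih =>
    change horner (addMulCoeffs c (addMulCoeffs _ (0 :: mulDeriv l) coeffs₁₂) derivCoeffs₁₂) x = _
    rw [horner_addMulCoeffs, horner_addMulCoeffs, horner_cons, horner_cons, hx, ih]
    push_cast
    ring

theorem horner_eq_sum {R : Type*} [CommRing R] (x : R) (n : ℕ) (l : List ℤ)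
    (h : ∀ c ∈ l.drop n, c = 0) :
    horner l x = ∑ i : Fin n, (l.getD i 0 : R) * x ^ (i : ℕ) := by
  induction n generalizing l with
  | zero =>
    induction l with
    | nil => simp [horner]
    | cons c l ih =>
      rw [horner_cons, ih fun d hd ↦ h d (by simp_all), h c (by simp)]
      simp
  | succ n ih =>
    rw [Fin.sum_univ_succ]
    cases l with
    | nil => simp [horner]
    | cons c l =>
      rw [horner_cons, ih l (by simpa using h), Finset.mul_sum]
      simp only [Fin.val_zero, List.getD_cons_zero, pow_zero, mul_one, Fin.val_succ,
        List.getD_cons_succ]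
      exact congrArg _ (Finset.sum_congr rfl fun i _ ↦ by ring)

/-- Coefficients of polynomials `s` of degrees `0, …, 11` such that the reduction of `f₁₂' * s`
modulo `f₁₂` is divisible by `X ^ s.natDegree`. -/
def triangularTable : List (List ℤ) :=
  [[1],
   [5, 4],
   [-25, -20, 236],
   [-745, -8602, 628, 4003],
   [112425, 1103270, -1590416, 163229, 669894],
   [-39966665, -457635054, -208737296, -146335501, 187001682, 64255064],
   [7039408695, 33814120942, -473623390461, 81659307535, -170003834644, 42709108743, 50302549079],
   [-4682549351710, -39713274596901, 76645768355728, -593919717081981, 99269091318575,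
    -68594779564206, 41823136490703, 44317494107021],
   [30178155236605, -18510227262857, -3020677673987256, 5564734483398299, -41687176865105428,
    6100790835637596, -4754476239598143, 3035823223505943, 3109747387191403],
   [-1444610664099713480, -14666180973420107453, 12507475251762518505, -13564711857846616960,
    24144775788522453509, 9243502617587406108, 3686540973439238028, -9520192334140643913,
    630535743195310465, 2153083663309023021],
   [106558457440568431850, 937843006786465011680, -2425962843389197470003, 1892977403403351214365,
    -2455098983627221285680, -3560729069604716331311, 1457045356755028991858,
    469359669709238066838, -631241575279183546813, 304808459680277209465, 220356059340659043011],
   [-63899624514128470214650, -646411489534218938831290, 585872292661852873812540,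
    -573986804358753402582603, 782017764243976670938695, 3464948742637557440122270,
    -654521677261619096798491, 124153397694902502917268, -200907295470368140146892,
    -210777120733517643711773, 44353763814344457254735, 24369014326106372134281]]

theorem triangularTable_spec : ∀ j : Fin 12,
    (∀ c ∈ (triangularTable.getD j []).drop (j + 1), c = 0) ∧
    (∀ c ∈ (mulDeriv (triangularTable.getD j [])).take j, c = 0) ∧
    ∀ c ∈ (mulDeriv (triangularTable.getD j [])).drop 12, c = 0 := by
  decide +kernel

theorem prod_triangularTable_ne_zero :
    ∏ j : Fin 12, (triangularTable.getD j []).getD j 0 ≠ 0 := by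
  decide +kernel

theorem prod_mulDeriv_triangularTable :
    ∏ j : Fin 12, (mulDeriv (triangularTable.getD j [])).getD j 0 =
      2 ^ 24 * 3 ^ 12 * 29 ^ 4 * 350113248049 ^ 2 *
        ∏ j : Fin 12, (triangularTable.getD j []).getD j 0 := by
  decide +kernel

section Discriminant

variable {K : Type*} [Field K] [CharZero K] {x : K}

theorem norm_derivative_f₁₂ (hx : aeval x f₁₂ = 0) (b : Module.Basis (Fin 12) ℚ K)
    (hb : ∀ i, b i = x ^ (i : ℕ)) :
    Algebra.norm ℚ (aeval x (derivative f₁₂)) =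
      2 ^ 24 * 3 ^ 12 * 29 ^ 4 * 350113248049 ^ 2 := by
  have hrepr (l : List ℤ) (hl : ∀ c ∈ l.drop 12, c = 0) (i : Fin 12) :
      b.repr (horner l x) i = l.getD i 0 := by
    have : horner l x = ∑ i : Fin 12, (l.getD i 0 : ℚ) • b i := by
      rw [horner_eq_sum x 12 l hl]
      exact Finset.sum_congr rfl fun i _ ↦ by rw [hb, Algebra.smul_def, map_intCast]
    rw [this, b.repr_sum_self]
  have hzero {l : List ℤ} {n k : ℕ} (h : ∀ c ∈ l.take n, c = 0) (hk : k < n) : l.getD k 0 = 0 := by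
    by_cases hkl : k < l.length
    · rw [List.getD_eq_getElem _ _ hkl]
      exact h _ (List.mem_take_iff_getElem.2 ⟨k, by omega, rfl⟩)
    · exact List.getD_eq_default _ _ (by omega)
  have hzero' {l : List ℤ} {n k : ℕ} (h : ∀ c ∈ l.drop n, c = 0) (hk : n ≤ k) :
      l.getD k 0 = 0 := by
    by_cases hkl : k < l.length
    · rw [List.getD_eq_getElem _ _ hkl]
      exact h _ (List.mem_drop_iff_getElem.2 ⟨k - n, by omega, by simp [hk]⟩)
    · exact List.getD_eq_default _ _ (by omega)
  have hdrop (j : Fin 12) : ∀ c ∈ (triangularTable.getD j []).drop 12, c = 0 := fun c hc ↦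
    (triangularTable_spec j).1 c (List.drop_subset_drop_left _ (by omega) hc)
  let S : Matrix (Fin 12) (Fin 12) ℚ := .of fun i j ↦ ((triangularTable.getD j []).getD i 0 : ℤ)
  let U : Matrix (Fin 12) (Fin 12) ℚ :=
    .of fun i j ↦ ((mulDeriv (triangularTable.getD j [])).getD i 0 : ℤ)
  have hS : S.det = ∏ j, S j j := Matrix.det_of_isUpperTriangular fun i j hij ↦ by
    exact Int.cast_eq_zero.2 (hzero' (triangularTable_spec j).1 hij)
  have hU : U.det = ∏ j, U j j := Matrix.det_of_isLowerTriangular _ fun i j hij ↦ by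
    exact Int.cast_eq_zero.2 (hzero (triangularTable_spec j).2.1 hij)
  have hf : horner coeffs₁₂ x = 0 := by rw [← aeval_ofCoeffs]; exact hx
  have hmul : Algebra.leftMulMatrix b (aeval x (derivative f₁₂)) * S = U := by
    ext i j
    have := congrFun (Algebra.leftMulMatrix_mulVec_repr b (aeval x (derivative f₁₂))
      (horner (triangularTable.getD j []) x)) i
    rw [derivative_f₁₂, aeval_ofCoeffs, ← horner_mulDeriv hf,
      hrepr _ (triangularTable_spec j).2.2] at this
    have hcol : (fun k ↦ S k j) = b.repr (horner (triangularTable.getD j []) x) :=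
      funext fun k ↦ (hrepr _ (hdrop j) k).symm
    rw [← hcol] at this
    rw [derivative_f₁₂, aeval_ofCoeffs]
    exact this
  have hS0 : S.det ≠ 0 := by
    simp only [hS, S, Matrix.of_apply]
    exact_mod_cast prod_triangularTable_ne_zero
  refine mul_right_cancel₀ hS0 ?_
  rw [Algebra.norm_eq_matrix_det b, ← Matrix.det_mul, hmul, hS, hU]
  simp only [S, U, Matrix.of_apply]
  exact_mod_cast prod_mulDeriv_triangularTable

theorem exists_basis_eq_pow (hirr : Irreducible (f₁₂.map (algebraMap ℤ ℚ))) (hx : aeval x f₁₂ = 0)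
    (htop : IntermediateField.adjoin ℚ {x} = ⊤) : ∃ b : Module.Basis (Fin 12) ℚ K,
      (∀ i, b i = x ^ (i : ℕ)) ∧
        |Algebra.discr ℚ b| = 2 ^ 24 * 3 ^ 12 * 29 ^ 4 * 350113248049 ^ 2 := by
  have h0 : aeval x (f₁₂.map (algebraMap ℤ ℚ)) = 0 := by rw [aeval_map_algebraMap, hx]
  have hmonic := monic_f₁₂.map (algebraMap ℤ ℚ)
  have hint : IsIntegral ℚ x := ⟨_, hmonic, h0⟩
  have hmin : f₁₂.map (algebraMap ℤ ℚ) = minpoly ℚ x :=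
    minpoly.eq_of_irreducible_of_monic hirr h0 hmonic
  have htop' : Algebra.adjoin ℚ {x} = ⊤ := by
    rw [← IntermediateField.adjoin_simple_toSubalgebra_of_isAlgebraic hint.isAlgebraic, htop,
      IntermediateField.top_toSubalgebra]
  let pb := PowerBasis.ofAdjoinEqTop hint htop'
  have hgen : pb.gen = x := PowerBasis.ofAdjoinEqTop_gen hint htop'
  have hdim : pb.dim = 12 := by
    rw [PowerBasis.ofAdjoinEqTop_dim, ← hmin, monic_f₁₂.natDegree_map, natDegree_f₁₂]
  let b : Module.Basis (Fin 12) ℚ K := pb.basis.reindex (finCongr hdim)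
  have hb (i) : b i = x ^ (i : ℕ) := by simp [b, hgen]
  have := pb.finite
  refine ⟨b, hb, ?_⟩
  have hdiscr : Algebra.discr ℚ b = Algebra.discr ℚ pb.basis := by
    rw [← Algebra.discr_reindex ℚ pb.basis (finCongr hdim), Module.Basis.coe_reindex]
  have hnorm := norm_derivative_f₁₂ hx b hb
  rw [← aeval_map_algebraMap ℚ, ← derivative_map] at hnorm
  rw [hdiscr, Algebra.discr_powerBasis_eq_norm, hgen, ← hmin, hnorm, abs_mul, abs_pow, abs_neg,
    abs_one, one_pow, one_mul]
  exact abs_of_pos (by norm_num)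

end Discriminant

section IntegralElement

variable {A : Type*} [CommRing A] {θ : A} {f : ℤ[X]}

theorem exists_pow_eq_mul_add_mul (hf : ∀ u : ℤ[X], aeval θ u = 0 → f ∣ u) {y : A}
    (hy : IsIntegral ℤ y) {a b : ℤ[X]} (hab : aeval θ a * y = aeval θ b) :
    ∃ (n : ℕ) (v s : ℤ[X]), b ^ n = a * v + f * s := by
  obtain ⟨m, hm, hm0⟩ := hy
  have hmC : (m.map (C : ℤ →+* ℤ[X])).Monic := hm.map C
  have h0 : aeval θ (((m.map C).scaleRoots a).eval b) = 0 := by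
    have := scaleRoots_eval₂_mul (p := m.map (C : ℤ →+* ℤ[X])) (aeval θ : ℤ[X] →ₐ[ℤ] A).toRingHom
      y a
    change eval₂ (aeval θ : ℤ[X] →ₐ[ℤ] A).toRingHom (aeval θ a * y) _ = _ at this
    rw [hab, eval₂_map] at this
    have hC : ((aeval θ : ℤ[X] →ₐ[ℤ] A).toRingHom).comp C = algebraMap ℤ A := RingHom.ext_int _ _
    rw [hC, hm0, mul_zero] at this
    rw [← this]
    exact (eval₂_hom (aeval θ : ℤ[X] →ₐ[ℤ] A).toRingHom b).symm
  obtain ⟨s, hs⟩ := hf _ h0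
  have h1 : Ideal.Quotient.mk (Ideal.span {a}) (((m.map C).scaleRoots a).eval b) =
      Ideal.Quotient.mk (Ideal.span {a}) (b ^ m.natDegree) := by
    rcases subsingleton_or_nontrivial (ℤ[X] ⧸ Ideal.span {a}) with hsub | hnon
    · exact Subsingleton.elim _ _
    · have hlc : Ideal.Quotient.mk (Ideal.span {a}) (m.map (C : ℤ →+* ℤ[X])).leadingCoeff ≠ 0 := by
        rw [hmC.leadingCoeff, map_one]
        exact one_ne_zero
      rw [← eval_map_apply, map_scaleRoots _ _ _ hlc, Ideal.Quotient.eq_zero_iff_mem.2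
        (Ideal.mem_span_singleton_self a), scaleRoots_zero, (hmC.map _).leadingCoeff, one_smul,
        eval_pow, eval_X, map_pow, (hm.map C).natDegree_map, hm.natDegree_map]
  rw [Ideal.Quotient.eq, Ideal.mem_span_singleton] at h1
  obtain ⟨v, hv⟩ := h1
  exact ⟨m.natDegree, -v, s, by rw [← hs]; linear_combination -hv⟩

theorem dvd_aeval_of_map_eq_zero {p : ℕ} {u : ℤ[X]}
    (hu : u.map (Int.castRingHom (ZMod p)) = 0) : (p : A) ∣ aeval θ u := by
  obtain ⟨v, rfl⟩ : C (p : ℤ) ∣ u := (C_dvd_iff_dvd_coeff _ _).2 fun i ↦ by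
    rw [← ZMod.intCast_zmod_eq_zero_iff_dvd]
    simpa using congrArg (coeff · i) hu
  exact ⟨aeval θ v, by simp⟩

/-- A form of Dedekind's criterion: the order `ℤ[θ]` is `p`-maximal. -/
theorem map_dvd_map_of_dvd_aeval [IsDomain A] [CharZero A] [Algebra.IsIntegral ℤ A]
    (hf : ∀ u : ℤ[X], aeval θ u = 0 → f ∣ u) (hθ : aeval θ f = 0) (hmonic : f.Monic)
    {p : ℕ} [Fact p.Prime] {h w F : ℤ[X]} (hfF : f = h * w + (p : ℤ[X]) * F) {e : ℕ} (he : w ∣ h ^ e)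
    (hsq : Squarefree (h.map (Int.castRingHom (ZMod p))))
    (hcop : IsCoprime (F.map (Int.castRingHom (ZMod p))) (w.map (Int.castRingHom (ZMod p))))
    {u : ℤ[X]} (hu : (p : A) ∣ aeval θ u) :
    f.map (Int.castRingHom (ZMod p)) ∣ u.map (Int.castRingHom (ZMod p)) := by
  classical
  set ρ := mapRingHom (Int.castRingHom (ZMod p)) with hρ
  change ρ f ∣ ρ u
  have hp0 : (p : A) ≠ 0 := Nat.cast_ne_zero.2 (Fact.out : p.Prime).ne_zero
  have hρp : ρ (p : ℤ[X]) = 0 := by rw [map_natCast, CharP.cast_eq_zero]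
  have hρf : ρ f = ρ h * ρ w := by rw [hfF]; simp [hρp]
  have hρf0 : ρ f ≠ 0 := (hmonic.map _).ne_zero
  have hsurj : Function.Surjective ρ := map_surjective _ (ZMod.ringHom_surjective _)
  by_contra hdvd
  obtain ⟨s, hs⟩ := gcd_dvd_left (ρ f) (ρ u)
  have hg0 : gcd (ρ f) (ρ u) ≠ 0 := fun h0 ↦ hρf0 ((gcd_eq_zero_iff _ _).1 h0).1
  have hs_unit : ¬IsUnit s := fun hu ↦ hdvd <| by
    obtain ⟨s', hs'⟩ := hu.exists_right_inv
    have : ρ f * s' = gcd (ρ f) (ρ u) := by rw [hs, mul_assoc, hs', mul_one, ← hs]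
    exact (Dvd.intro _ this).trans (gcd_dvd_right _ _)
  have hs0 : s ≠ 0 := by rintro rfl; exact hρf0 (by rw [hs, mul_zero])
  obtain ⟨π, hπ, t, rfl⟩ := WfDvdMonoid.exists_irreducible_factor hs_unit hs0
  have hπf : π ∣ ρ f := hs ▸ (Dvd.intro t rfl).mul_left _
  have hπh : π ∣ ρ h := by
    rcases hπ.prime.dvd_or_dvd (hρf ▸ hπf) with h' | h'
    · exact h'
    · refine hπ.prime.dvd_of_dvd_pow (h'.trans ?_) (n := e)
      rw [← map_pow]
      exact map_dvd ρ he
  obtain ⟨k, hk⟩ := hπh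
  obtain ⟨k, rfl⟩ := hsurj k
  -- `k * w` lifts `f / π`, so its value at `θ` is divisible by `p`
  have hkw : (p : A) ∣ aeval θ (k * w) := by
    have hkw' : ρ (k * w) = gcd (ρ f) (ρ u) * t := by
      refine mul_left_cancel₀ hπ.ne_zero ?_
      rw [map_mul, ← mul_assoc, ← hk, ← hρf, mul_left_comm, ← hs]
    obtain ⟨c, d, hcd⟩ := exists_gcd_eq_mul_add_mul (ρ f) (ρ u)
    obtain ⟨c, rfl⟩ := hsurj c
    obtain ⟨d, rfl⟩ := hsurj d
    obtain ⟨t, rfl⟩ := hsurj t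
    have h0 : ρ (k * w - (f * c + u * d) * t) = 0 := by
      rw [map_sub, hkw', hcd]
      simp
    have := dvd_aeval_of_map_eq_zero (θ := θ) h0
    rw [map_sub, map_mul _ (_ + _), map_add, map_mul _ f, hθ, zero_mul, zero_add] at this
    refine (dvd_sub_left ?_).1 this
    rw [map_mul]
    exact (hu.mul_right _).mul_right _
  obtain ⟨y, hy⟩ := hkw
  have hyint : IsIntegral ℤ y := Algebra.IsIntegral.isIntegral y
  obtain ⟨n, v, z, h1⟩ := exists_pow_eq_mul_add_mul hf hyint (a := (p : ℤ[X])) (b := k * w)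
    (by rw [hy, map_natCast])
  obtain ⟨n', v', z', h2⟩ := exists_pow_eq_mul_add_mul hf hyint (a := h) (b := -(k * F)) (by
    refine mul_left_cancel₀ hp0 ?_
    have : aeval θ h * aeval θ w + p * aeval θ F = 0 := by
      rw [← hθ]; conv_rhs => rw [hfF]
      simp
    rw [map_neg, map_mul]
    rw [map_mul] at hy
    linear_combination aeval θ h * (-hy) + aeval θ k * this)
  have hπk : ¬π ∣ ρ k := fun ⟨k', hk'⟩ ↦ hπ.not_isUnit (hsq π ⟨k', by
    change ρ h = _
    rw [hk, hk', mul_assoc]⟩)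
  have hπw : π ∣ ρ w := by
    have : π ∣ ρ (k * w) ^ n := by
      rw [← map_pow, h1, map_add, map_mul, map_mul, hρp, zero_mul, zero_add]
      exact hπf.mul_right _
    have := hπ.prime.dvd_of_dvd_pow this
    rw [map_mul] at this
    exact (hπ.prime.dvd_or_dvd this).resolve_left hπk
  have hπF : π ∣ ρ F := by
    have : π ∣ ρ (-(k * F)) ^ n' := by
      rw [← map_pow, h2, map_add, map_mul, map_mul]
      exact dvd_add ((Dvd.intro _ hk.symm).mul_right _) (hπf.mul_right _)
    have := hπ.prime.dvd_of_dvd_pow this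
    rw [map_neg, dvd_neg, map_mul] at this
    exact (hπ.prime.dvd_or_dvd this).resolve_left hπk
  exact hπ.not_isUnit (hcop.isUnit_of_dvd' hπF hπw)

end IntegralElement

section IntegralMatrix

open NumberField

variable {K : Type*} [Field K] [NumberField K] {n : ℕ} {θ : 𝓞 K}

/-- The matrix of the powers of an integral generator with respect to an integral basis. -/
theorem exists_matrix_discr_eq (b : Module.Basis (Fin n) ℚ K) (hb : ∀ i, b i = (θ : K) ^ (i : ℕ)) :
    ∃ P : Matrix (Fin n) (Fin n) ℤ, Algebra.discr ℚ b = (P.det ^ 2 * discr K : ℤ) ∧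
      ∀ (m : ℤ) (u : ℤ[X]), u.natDegree < n → ((m : 𝓞 K) ∣ aeval θ u ↔
        ∀ j, m ∣ (Matrix.vecMul (fun i : Fin n ↦ u.coeff i) P) j) := by
  have hcard : Fintype.card (Module.Free.ChooseBasisIndex ℤ (𝓞 K)) = n := by
    rw [← Module.finrank_eq_card_chooseBasisIndex, RingOfIntegers.rank,
      Module.finrank_eq_card_basis b, Fintype.card_fin]
  let ω := (RingOfIntegers.basis K).reindex (Fintype.equivFinOfCardEq hcard)
  let P : Matrix (Fin n) (Fin n) ℤ := .of fun i j ↦ ω.repr (θ ^ (i : ℕ)) j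
  have hP : (fun i : Fin n ↦ θ ^ (i : ℕ)) = (P.map (algebraMap ℤ (𝓞 K))).mulVec ω := by
    funext i
    rw [← ω.sum_repr (θ ^ (i : ℕ))]
    exact Finset.sum_congr rfl fun j _ ↦ Algebra.smul_def _ _
  refine ⟨P, ?_, fun m u hu ↦ ?_⟩
  · rw [← NumberField.discr_eq_discr K ω, ← Algebra.discr_of_matrix_mulVec, ← hP, Algebra.discr_def,
      Algebra.discr_def]
    refine Eq.trans ?_ (RingHom.map_det (Int.castRingHom ℚ) _).symm
    congr 1
    ext i j
    simp only [Algebra.traceMatrix_apply, Algebra.traceForm_apply, hb, RingHom.mapMatrix_apply,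
      Matrix.map_apply, eq_intCast]
    exact (congrArg _ (by simp)).trans (Algebra.coe_trace_int (θ ^ (i : ℕ) * θ ^ (j : ℕ))).symm
  · have h1 (j) : ω.repr (aeval θ u) j = (Matrix.vecMul (fun i : Fin n ↦ u.coeff i) P) j := by
      rw [aeval_eq_sum_range' hu, Finset.sum_range]
      simp only [map_sum, map_smul, Finsupp.finsetSum_apply, Finsupp.smul_apply]
      rfl
    simp only [← h1]
    refine ⟨fun ⟨y, hy⟩ j ↦ ⟨ω.repr y j, ?_⟩, fun h ↦ ?_⟩
    · rw [hy, ← zsmul_eq_mul, map_zsmul]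
      rfl
    · choose c hc using h
      refine ⟨∑ j, c j • ω j, ?_⟩
      rw [← ω.sum_repr (aeval θ u), Finset.mul_sum]
      exact Finset.sum_congr rfl fun j _ ↦ by rw [hc, mul_smul, zsmul_eq_mul]

theorem not_dvd_det_of_forall_dvd {P : Matrix (Fin n) (Fin n) ℤ} {f : ℤ[X]} (hf : f.Monic)
    (hdeg : f.natDegree = n) {p : ℕ} [Fact p.Prime]
    (hP : ∀ u : ℤ[X], u.natDegree < n →
      (∀ j, (p : ℤ) ∣ (Matrix.vecMul (fun i : Fin n ↦ u.coeff i) P) j) →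
        f.map (Int.castRingHom (ZMod p)) ∣ u.map (Int.castRingHom (ZMod p))) :
    ¬(p : ℤ) ∣ P.det := by
  intro hdvd
  have hdet : (P.map (Int.castRingHom (ZMod p))).det = 0 := by
    rw [← RingHom.mapMatrix_apply, ← RingHom.map_det]
    exact (ZMod.intCast_zmod_eq_zero_iff_dvd _ _).2 hdvd
  obtain ⟨v, hv0, hv⟩ := Matrix.exists_vecMul_eq_zero_iff.2 hdet
  obtain ⟨v, rfl⟩ : ∃ v' : Fin n → ℤ, v = fun i ↦ (v' i : ZMod p) :=
    ⟨fun i ↦ (v i).cast, by simp⟩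
  have hn : 1 ≤ n := by
    by_contra! h
    obtain rfl : n = 0 := by omega
    exact hv0 (Subsingleton.elim _ _)
  have hcoeff (i : Fin n) : (ofFn n v).coeff i = v i := ofFn_coeff_eq_val_of_lt v i.2
  have hmap : (ofFn n v).map (Int.castRingHom (ZMod p)) = 0 := by
    refine eq_zero_of_dvd_of_natDegree_lt
      (hP (ofFn n v) (ofFn_natDegree_lt hn v) fun j ↦ ?_) ?_
    · rw [← ZMod.intCast_zmod_eq_zero_iff_dvd]
      simp only [hcoeff]
      have := congrFun hv j
      refine Eq.trans ?_ this
      simp [Matrix.vecMul, dotProduct]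
    · rw [hf.natDegree_map, hdeg]
      exact natDegree_map_le.trans_lt (ofFn_natDegree_lt hn v)
  refine hv0 (funext fun i ↦ ?_)
  simpa [hcoeff] using congrArg (coeff · (i : ℕ)) hmap

theorem dvd_det_of_monic {P : Matrix (Fin n) (Fin n) ℤ} {g : ℤ[X]} (hg : g.Monic)
    (hdeg : g.natDegree < n) {m : ℤ}
    (hm : ∀ j, m ∣ (Matrix.vecMul (fun i : Fin n ↦ g.coeff i) P) j) : m ∣ P.det := by
  choose c hc using hm
  have h := congrFun (Matrix.vecMul_vecMul (fun i : Fin n ↦ g.coeff i) P P.adjugate)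
    ⟨g.natDegree, hdeg⟩
  rw [Matrix.mul_adjugate, Matrix.vecMul_smul, Matrix.vecMul_one, Pi.smul_apply,
    hg.coeff_natDegree, smul_eq_mul, mul_one] at h
  rw [← h, Matrix.vecMul, dotProduct]
  exact Finset.dvd_sum fun i _ ↦ (Dvd.intro _ (hc i).symm).mul_right _

end IntegralMatrix

section Maximality

variable {p : ℕ}

theorem isCoprime_map_of_eq_one_add {a b s F w : ℤ[X]} (h : a * F + b * w = 1 + (p : ℤ[X]) * s) :
    IsCoprime (F.map (Int.castRingHom (ZMod p))) (w.map (Int.castRingHom (ZMod p))) :=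
  ⟨a.map (Int.castRingHom (ZMod p)), b.map (Int.castRingHom (ZMod p)), by
    simpa using congrArg (Polynomial.map (Int.castRingHom (ZMod p))) h⟩

theorem squarefree_map_of_eq_one_add {a b s h : ℤ[X]} [Fact p.Prime]
    (hab : a * h + b * derivative h = 1 + (p : ℤ[X]) * s) :
    Squarefree (h.map (Int.castRingHom (ZMod p))) := by
  refine Separable.squarefree ?_
  rw [Separable, derivative_map]
  exact isCoprime_map_of_eq_one_add hab

variable {A : Type*} [CommRing A] [IsDomain A] [CharZero A] [Algebra.IsIntegral ℤ A] {θ : A}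

theorem map_two_dvd_of_two_dvd_aeval (hf : ∀ u : ℤ[X], aeval θ u = 0 → f₁₂ ∣ u)
    (hθ : aeval θ f₁₂ = 0) {u : ℤ[X]} (hu : ((2 : ℕ) : A) ∣ aeval θ u) :
    f₁₂.map (Int.castRingHom (ZMod 2)) ∣ u.map (Int.castRingHom (ZMod 2)) := by
  refine map_dvd_map_of_dvd_aeval hf hθ monic_f₁₂ (h := X ^ 3 + X ^ 2 + 1)
    (w := (X ^ 3 + X ^ 2 + 1) ^ 3)
    (F := -2 * X ^ 11 - 9 * X ^ 10 + 4 * X ^ 8 - 24 * X ^ 7 + 91 * X ^ 6 - 126 * X ^ 5 - 45 * X ^ 4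
      + 32 * X ^ 3 - 38 * X ^ 2 + 24 * X + 2) (e := 3) ?_ dvd_rfl ?_ ?_ hu
  · rw [f₁₂_eq]
    push_cast
    ring
  · refine squarefree_map_of_eq_one_add (a := 1) (b := X + 1) (s := 2 * X ^ 3 + 3 * X ^ 2 + X) ?_
    simp only [derivative_add, derivative_X_pow, derivative_one, map_natCast]
    push_cast
    ring
  · rw [Polynomial.map_pow]
    refine (isCoprime_map_of_eq_one_add (a := X + 1) (b := X ^ 8 + X ^ 5 + X ^ 3 + X ^ 2 + 1)
      (s := -X ^ 12 - 5 * X ^ 11 - 4 * X ^ 10 + 2 * X ^ 9 - 9 * X ^ 8 + 34 * X ^ 7 - 17 * X ^ 6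
        - 84 * X ^ 5 - 6 * X ^ 4 - 2 * X ^ 3 - 6 * X ^ 2 + 13 * X + 1) ?_).pow_right
    push_cast
    ring

theorem map_three_dvd_of_three_dvd_aeval (hf : ∀ u : ℤ[X], aeval θ u = 0 → f₁₂ ∣ u)
    (hθ : aeval θ f₁₂ = 0) {u : ℤ[X]} (hu : ((3 : ℕ) : A) ∣ aeval θ u) :
    f₁₂.map (Int.castRingHom (ZMod 3)) ∣ u.map (Int.castRingHom (ZMod 3)) := by
  refine map_dvd_map_of_dvd_aeval hf hθ monic_f₁₂ (h := X ^ 4 - X ^ 3 - X - 1)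
    (w := (X ^ 4 - X ^ 3 - X - 1) ^ 2)
    (F := X ^ 11 - 5 * X ^ 10 + 4 * X ^ 9 + 6 * X ^ 8 - 13 * X ^ 7 + 64 * X ^ 6 - 81 * X ^ 5
      - 27 * X ^ 4 + 24 * X ^ 3 - 23 * X ^ 2 + 17 * X + 2) (e := 2) ?_ dvd_rfl ?_ ?_ hu
  · rw [f₁₂_eq]
    push_cast
    ring
  · refine squarefree_map_of_eq_one_add (a := 1) (b := -X + 1)
      (s := -X ^ 4 + 2 * X ^ 3 - X ^ 2 - 1) ?_
    simp only [derivative_sub, derivative_X_pow, derivative_one, derivative_X, map_natCast]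
    push_cast
    ring
  · rw [Polynomial.map_pow]
    refine (isCoprime_map_of_eq_one_add (a := X ^ 2)
      (b := -X ^ 9 + X ^ 8 - X ^ 6 - X ^ 3 + X ^ 2 + X - 1)
      (s := -X ^ 12 + X ^ 11 + 2 * X ^ 10 - 4 * X ^ 9 + 21 * X ^ 8 - 27 * X ^ 7 - 8 * X ^ 6
        + 8 * X ^ 5 - 8 * X ^ 4 + 6 * X ^ 3) ?_).pow_right
    push_cast
    ring

instance fact_prime_twentyNine : Fact (Nat.Prime 29) := ⟨by norm_num⟩

theorem map_twentyNine_dvd_of_twentyNine_dvd_aeval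
    (hf : ∀ u : ℤ[X], aeval θ u = 0 → f₁₂ ∣ u) (hθ : aeval θ f₁₂ = 0) {u : ℤ[X]}
    (hu : ((29 : ℕ) : A) ∣ aeval θ u) :
    f₁₂.map (Int.castRingHom (ZMod 29)) ∣ u.map (Int.castRingHom (ZMod 29)) := by
  refine map_dvd_map_of_dvd_aeval hf hθ monic_f₁₂
    (h := (X ^ 4 - 5 * X ^ 3 + 13 * X ^ 2 - 13 * X + 8) *
      (X ^ 4 + 10 * X ^ 3 + 8 * X ^ 2 - 5 * X - 4))
    (w := X ^ 4 - 5 * X ^ 3 + 13 * X ^ 2 - 13 * X + 8)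
    (F := X ^ 10 - 9 * X ^ 9 + 28 * X ^ 8 - 45 * X ^ 7 + 31 * X ^ 6 + 17 * X ^ 5 - 66 * X ^ 4
      + 45 * X ^ 3 - 4 * X ^ 2 - 16 * X + 9) (e := 1) ?_ ?_ ?_ ?_ hu
  · rw [f₁₂_eq]
    push_cast
    ring
  · rw [pow_one]
    exact dvd_mul_right _ _
  · refine squarefree_map_of_eq_one_add
      (a := -X ^ 6 - 9 * X ^ 4 + 8 * X ^ 3 + 6 * X ^ 2 - 12 * X - 2)
      (b := 11 * X ^ 7 - 4 * X ^ 6 - 14 * X ^ 5 + 4 * X ^ 4 - 8 * X ^ 3 - 11 * X ^ 2 + 12 * X + 2)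
      (s := 3 * X ^ 14 + 12 * X ^ 13 - 74 * X ^ 12 + 141 * X ^ 11 + 52 * X ^ 10 - 318 * X ^ 9
        + 177 * X ^ 8 + 115 * X ^ 7 - 383 * X ^ 6 + 202 * X ^ 5 + 125 * X ^ 4 - 180 * X ^ 3
        + 28 * X ^ 2 + 28 * X + 3) ?_
    simp only [derivative_mul, derivative_add, derivative_sub, derivative_X_pow, derivative_X,
      derivative_ofNat, map_natCast]
    push_cast
    ring
  · refine isCoprime_map_of_eq_one_add (a := 14 * X ^ 3 + 12 * X ^ 2 - 14 * X + 5)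
      (b := -14 * X ^ 9 - 14 * X ^ 8 - 13 * X ^ 7 + 11 * X ^ 6 + X ^ 5 - 9 * X ^ 4 + 2 * X ^ 3
        + 7 * X ^ 2 - 14 * X + 9)
      (s := -2 * X ^ 12 + 5 * X ^ 11 - 3 * X ^ 10 - 24 * X ^ 9 + 54 * X ^ 8 - 54 * X ^ 7
        - 10 * X ^ 6 + 55 * X ^ 5 - 40 * X ^ 4 - 3 * X ^ 3 + 23 * X ^ 2 - 15 * X + 4) ?_
    push_cast
    ring

end Maximality

section Discriminant

/-- A root modulo `N²` of `f` that is a double root modulo `N` yields an integral element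
with denominator `N`. -/
theorem dvd_aeval_divByMonic_of_eval_eq {A : Type*} [CommRing A] [IsDomain A]
    [IsIntegrallyClosed A] {θ : A} {f : ℤ[X]} (hθ : aeval θ f = 0) {c N s t : ℤ}
    (hN : (N : A) ≠ 0) (h0 : f.eval c = N ^ 2 * t) (h1 : f.derivative.eval c = N * s) :
    (N : A) ∣ aeval θ (f /ₘ (X - C c)) := by
  set g := f /ₘ (X - C c) with hg
  have hfg : (X - C c) * g = f - C (N ^ 2 * t) := by
    rw [X_sub_C_mul_divByMonic_eq_sub_modByMonic, modByMonic_X_sub_C_eq_C_eval, h0]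
  have hgc : g.eval c = N * s := by
    rw [← h1, ← divByMonic_add_X_sub_C_mul_derivative_divByMonic_eq_derivative f c]
    simp [hg]
  have hgh : (X - C c) * (g /ₘ (X - C c)) = g - C (N * s) := by
    rw [X_sub_C_mul_divByMonic_eq_sub_modByMonic, modByMonic_X_sub_C_eq_C_eval, hgc]
  replace hfg := congrArg (aeval θ) hfg
  generalize g /ₘ (X - C c) = h at hgh
  replace hgh := congrArg (aeval θ) hgh
  simp only [map_mul, map_sub, aeval_X, aeval_C, hθ, map_pow, algebraMap_int_eq] at hfg hgh
  simp only [eq_intCast] at hfg hgh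
  have hN' : algebraMap A (FractionRing A) N ≠ 0 := by
    simpa using (IsFractionRing.injective A (FractionRing A)).ne hN
  have hint : IsIntegral A (algebraMap A (FractionRing A) (aeval θ g) /
      algebraMap A (FractionRing A) N) := by
    refine ⟨X ^ 2 + (C (-(s : A)) * X + C (t * aeval θ h)), ?_, ?_⟩
    · refine monic_X_pow_add (degree_linear_le.trans_lt ?_)
      norm_num
    · have : aeval θ g ^ 2 - N * s * aeval θ g + N ^ 2 * (t * aeval θ h) = 0 := by
        linear_combination -aeval θ g * hgh + aeval θ h * hfg
      replace this := congrArg (algebraMap A (FractionRing A)) this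
      simp only [map_add, map_sub, map_mul, map_pow, map_zero] at this
      simp only [eval₂_add, eval₂_mul, eval₂_C, eval₂_X, eval₂_pow]
      simp only [map_neg, map_mul]
      field_simp
      linear_combination this
  obtain ⟨y, hy⟩ := IsIntegrallyClosed.isIntegral_iff.1 hint
  refine ⟨y, IsFractionRing.injective A (FractionRing A) ?_⟩
  rw [map_mul, hy]
  field_simp

theorem abs_eq_of_abs_sq_mul_eq {d D B N : ℤ} (hN : 0 < N) (hNd : N ∣ d)
    (hcop : IsCoprime B d) (h : |d ^ 2 * D| = B * N ^ 2) : |D| = B := by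
  obtain ⟨e, rfl⟩ := hNd
  have h1 : e ^ 2 * |D| = B := by
    refine mul_right_cancel₀ (pow_ne_zero 2 hN.ne') ?_
    rw [← h, abs_mul, abs_of_nonneg (sq_nonneg (N * e))]
    ring
  have h2 : IsUnit e := hcop.isUnit_of_dvd' ⟨e * |D|, by rw [← h1]; ring⟩ (dvd_mul_left _ _)
  rcases Int.isUnit_iff.1 h2 with rfl | rfl <;> simpa using h1

theorem abs_discr_eq {K : Type*} [Field K] [NumberField K]
    (hirr : Irreducible (f₁₂.map (algebraMap ℤ ℚ))) {x : K} (hx : aeval x f₁₂ = 0)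
    (htop : IntermediateField.adjoin ℚ {x} = ⊤) :
    |NumberField.discr K| = 2 ^ 24 * 3 ^ 12 * 29 ^ 4 := by
  obtain ⟨b, hb, hdisc⟩ := exists_basis_eq_pow hirr hx htop
  obtain ⟨θ, rfl⟩ : ∃ θ : NumberField.RingOfIntegers K, (θ : K) = x :=
    ⟨⟨x, f₁₂, monic_f₁₂, hx⟩, rfl⟩
  obtain ⟨P, hP, hdvd⟩ := exists_matrix_discr_eq b hb
  have hcoe (u : ℤ[X]) : aeval (θ : K) u = (aeval θ u : NumberField.RingOfIntegers K) :=
    aeval_algebraMap_apply K θ u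
  have hθ : aeval θ f₁₂ = 0 := by
    refine NumberField.RingOfIntegers.ext ?_
    rw [← hcoe, hx]
    exact (map_zero _).symm
  have hf (u : ℤ[X]) (hu : aeval θ u = 0) : f₁₂ ∣ u := by
    rw [← map_dvd_map _ (algebraMap ℤ ℚ).injective_int monic_f₁₂,
      minpoly.eq_of_irreducible_of_monic hirr (x := (θ : K)) (by rwa [aeval_map_algebraMap])
        (monic_f₁₂.map _)]
    refine minpoly.dvd ℚ _ ?_
    rw [aeval_map_algebraMap, hcoe, hu]
    exact map_zero _
  have hndvd {p : ℕ} [Fact p.Prime]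
      (h : ∀ {u : ℤ[X]}, (p : NumberField.RingOfIntegers K) ∣ aeval θ u →
        f₁₂.map (Int.castRingHom (ZMod p)) ∣ u.map (Int.castRingHom (ZMod p))) :
      IsCoprime (p : ℤ) P.det := by
    refine (Prime.coprime_iff_not_dvd (Nat.prime_iff_prime_int.1 Fact.out)).2 ?_
    refine not_dvd_det_of_forall_dvd monic_f₁₂ natDegree_f₁₂ fun u hu hj ↦ h ?_
    exact_mod_cast (hdvd p u hu).2 hj
  have hmonic : (f₁₂ /ₘ (X - C (-23598155178))).Monic := by
    rw [Monic, leadingCoeff_divByMonic_X_sub_C]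
    · exact monic_f₁₂
    · rw [degree_eq_natDegree monic_f₁₂.ne_zero, natDegree_f₁₂]
      norm_num
  have hdeg : (f₁₂ /ₘ (X - C (-23598155178))).natDegree < 12 := by
    rw [natDegree_divByMonic _ (monic_X_sub_C _), natDegree_f₁₂, natDegree_X_sub_C]
    norm_num
  have hN : (350113248049 : ℤ) ∣ P.det := by
    refine dvd_det_of_monic hmonic hdeg ((hdvd _ _ hdeg).1 ?_)
    refine dvd_aeval_divByMonic_of_eval_eq hθ (Int.cast_ne_zero.2 (by norm_num))
      (t := 243287358433505602234663154076172214336428672349412111084141612631052213918745073491245509795064371013)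
      (s := -43314298068431450326377711601703556452282494446573995375422347410690205667125103511973430601868199305216)
      ?_ ?_
    · rw [← coe_aeval_eq_eval, f₁₂, aeval_ofCoeffs]
      simp only [horner, coeffs₁₂, List.foldr]
      norm_num
    · rw [← coe_aeval_eq_eval, derivative_f₁₂, aeval_ofCoeffs]
      simp only [horner, derivCoeffs₁₂, List.foldr]
      norm_num
  refine abs_eq_of_abs_sq_mul_eq (by norm_num) hN ?_ ?_
  · exact ((hndvd (map_two_dvd_of_two_dvd_aeval hf hθ)).pow_left.mul_left
      (hndvd (map_three_dvd_of_three_dvd_aeval hf hθ)).pow_left).mul_left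
      (hndvd (map_twentyNine_dvd_of_twentyNine_dvd_aeval hf hθ)).pow_left
  · rw [hP] at hdisc
    exact_mod_cast hdisc

end Discriminant

/-- The polynomial `f₁₂` is irreducible over `ℚ`, its Galois group has
order `95040` (the order of the Mathieu group `M₁₂`), and the number field `ℚ[x]/(f₁₂)`
(i.e. any number field generated by a root of `f₁₂`) has discriminant of absolute value
`2²⁴·3¹²·29⁴`. -/
theorem f12_irreducible_galM12_and_discr :
    let f : Polynomial ℚ :=
      X ^ 12 - 12 * X ^ 10 + 8 * X ^ 9 + 21 * X ^ 8 - 36 * X ^ 7 + 192 * X ^ 6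
        - 240 * X ^ 5 - 84 * X ^ 4 + 68 * X ^ 3 - 72 * X ^ 2 + 48 * X + 5
    Irreducible f ∧ Nat.card f.Gal = 95040 ∧
      ∀ (K : Type) [Field K] [NumberField K] (x : K),
        Polynomial.aeval x f = 0 → IntermediateField.adjoin ℚ {x} = ⊤ →
        |NumberField.discr K| = 2 ^ 24 * 3 ^ 12 * 29 ^ 4 := by
  intro f
  have hf : f = f₁₂.map (algebraMap ℤ ℚ) := by
    simp [f, f₁₂_eq]
  rw [hf]
  refine ⟨irreducible_f₁₂_and_natCard_gal.1, irreducible_f₁₂_and_natCard_gal.2, ?_⟩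
  intro K _ _ x hx htop
  rw [aeval_map_algebraMap] at hx
  exact abs_discr_eq irreducible_f₁₂_and_natCard_gal.1 hx htop
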